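/- arXiv:2504.00346 — 2 statements merged into one kernel-verified Lean document; each statement's English description precedes it below -/
import Mathlib

section
/- There exists a constant τ ∈ (0, 1/20) such that the following holds. Let F_q ⊆ F_{q'} be finite fields and let d < q. Let f : F_q³ → F_{q'} and let T be a degree-d lines table on F_q³, i.e., an assignment of a degree-≤d function T[L] : L → F_{q'} to every affine line L ⊆ F_q³. If Pr_L[f|_L = T[L]] = ε (probability over a uniformly random affine line L of F_q³) and ε⁶ ≥ √(d/q), then there exists a degree-≤d function Q : F_q³ → F_{q'} such that Pr_{a ∈ F_q³}[Q(a) = f(a)] ≥ 0.49·ε − 1.01·(d/q)^τ. -/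
namespace Paper

/-- Fractional agreement between two functions on a finite domain. -/
noncomputable def agr {U V : Type*} [Fintype U] (f g : U → V) : ℝ :=
  (Nat.card {x : U // f x = g x} : ℝ) / Fintype.card U

/-- `F : F_q^m → F_{q'}` has (total) degree at most `d`. -/
def IsDegLE {Fq Fq' : Type} [Field Fq] [Field Fq'] (ι : Fq →+* Fq') (m d : ℕ)
    (F : (Fin m → Fq) → Fq') : Prop :=
  ∃ p : MvPolynomial (Fin m) Fq', p.totalDegree ≤ d ∧
    ∀ x, F x = MvPolynomial.eval (fun i => ι (x i)) p

set_option linter.unusedSectionVars false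
open Classical in
/-- Real-valued indicator of a proposition. -/
noncomputable def ind (P : Prop) : ℝ := if P then 1 else 0

/-- Real-valued number of points satisfying a predicate. -/
noncomputable def cnt {α : Type*} [Fintype α] (P : α → Prop) : ℝ := ∑ x, ind (P x)

lemma ind_nonneg (P : Prop) : 0 ≤ ind P := by unfold ind; split_ifs <;> norm_num
lemma ind_le_one (P : Prop) : ind P ≤ 1 := by unfold ind; split_ifs <;> norm_num
lemma ind_true {P : Prop} (h : P) : ind P = 1 := by simp [ind, h]
lemma ind_false {P : Prop} (h : ¬ P) : ind P = 0 := by simp [ind, h]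
lemma ind_mono {P Q : Prop} (h : P → Q) : ind P ≤ ind Q := by
  by_cases hP : P
  · rw [ind_true hP, ind_true (h hP)]
  · rw [ind_false hP]; exact ind_nonneg _
lemma ind_congr {P Q : Prop} (h : P ↔ Q) : ind P = ind Q := by rw [propext h]

section cnt
variable {α β : Type*} [Fintype α] [Fintype β]

lemma cnt_nonneg (P : α → Prop) : 0 ≤ cnt P := Finset.sum_nonneg fun _ _ => ind_nonneg _

lemma cnt_mono {P Q : α → Prop} (h : ∀ x, P x → Q x) : cnt P ≤ cnt Q :=
  Finset.sum_le_sum fun x _ => ind_mono (h x)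

lemma cnt_congr {P Q : α → Prop} (h : ∀ x, P x ↔ Q x) : cnt P = cnt Q :=
  Finset.sum_congr rfl fun x _ => ind_congr (h x)

lemma cnt_le_card (P : α → Prop) : cnt P ≤ Fintype.card α := by
  calc cnt P ≤ ∑ _x : α, (1 : ℝ) := Finset.sum_le_sum fun x _ => ind_le_one _
    _ = _ := by simp

lemma cnt_equiv (e : α ≃ β) (P : β → Prop) : cnt (fun x => P (e x)) = cnt P :=
  Equiv.sum_comp e fun y => ind (P y)

lemma cnt_prod (P : α × β → Prop) : cnt P = ∑ a, cnt fun b => P (a, b) :=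
  Fintype.sum_prod_type _

lemma cnt_prod' (P : α × β → Prop) : cnt P = ∑ b, cnt fun a => P (a, b) :=
  Fintype.sum_prod_type_right _

lemma cnt_comm (P : α → β → Prop) : ∑ a, cnt (fun b => P a b) = ∑ b, cnt fun a => P a b :=
  Finset.sum_comm

lemma cnt_or_le (P Q : α → Prop) : cnt (fun x => P x ∨ Q x) ≤ cnt P + cnt Q := by
  unfold cnt
  rw [← Finset.sum_add_distrib]
  refine Finset.sum_le_sum fun x _ => ?_
  by_cases hP : P x
  · rw [ind_true (Or.inl hP), ind_true hP]; linarith [ind_nonneg (Q x)]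
  · rw [ind_false hP, zero_add]; exact ind_mono fun h => h.resolve_left hP

lemma cnt_add_not (P : α → Prop) : cnt P + cnt (fun x => ¬ P x) = Fintype.card α := by
  unfold cnt
  rw [← Finset.sum_add_distrib]
  have : ∀ x ∈ Finset.univ, ind (P x) + ind (¬ P x) = (1 : ℝ) := by
    intro x _
    by_cases hP : P x
    · rw [ind_true hP, ind_false (not_not.2 hP)]; ring
    · rw [ind_false hP, ind_true hP]; ring
  rw [Finset.sum_congr rfl this]; simp

open Classical in
lemma cnt_eq_card (P : α → Prop) : cnt P = ((Finset.univ.filter P).card : ℝ) := by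
  simp [cnt, ind]

lemma cnt_eq_natCard (P : α → Prop) : cnt P = (Nat.card {x // P x} : ℝ) := by
  classical
  rw [cnt_eq_card, Nat.card_eq_fintype_card, Fintype.card_subtype]

/-- Union bound over a finite set. -/
lemma cnt_exists_le {γ : Type*} (s : Finset γ) (P : γ → α → Prop) :
    cnt (fun x => ∃ c ∈ s, P c x) ≤ ∑ c ∈ s, cnt (P c) := by
  unfold cnt
  rw [Finset.sum_comm]
  refine Finset.sum_le_sum fun x _ => ?_
  by_cases h : ∃ c ∈ s, P c x
  · obtain ⟨c, hc, hP⟩ := h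
    rw [ind_true ⟨c, hc, hP⟩, ← ind_true hP]
    exact Finset.single_le_sum (f := fun c => ind (P c x)) (fun _ _ => ind_nonneg _) hc
  · rw [ind_false h]; exact Finset.sum_nonneg fun _ _ => ind_nonneg _

/-- Averaging. -/
lemma exists_ge_of_sum {g : α → ℝ} {c : ℝ} [Nonempty α]
    (h : c * Fintype.card α ≤ ∑ x, g x) : ∃ x, c ≤ g x := by
  by_contra hn
  push Not at hn
  have : ∑ x, g x < ∑ _x : α, c :=
    Finset.sum_lt_sum_of_nonempty Finset.univ_nonempty fun x _ => hn x
  simp at this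
  linarith

/-- Markov. -/
lemma markov (P : α → Prop) (g : α → ℝ) (θ : ℝ) (hg : ∀ x, 0 ≤ g x) (h : ∀ x, P x → θ ≤ g x) :
    cnt P * θ ≤ ∑ x, g x := by
  unfold cnt
  rw [Finset.sum_mul]
  refine Finset.sum_le_sum fun x _ => ?_
  by_cases hP : P x
  · rw [ind_true hP, one_mul]; exact h x hP
  · rw [ind_false hP, zero_mul]; exact hg x

end cnt


section low
open Polynomial
variable {F K : Type} [Field F] [Fintype F] [Field K] (ι : F →+* K)

/-- A univariate function of degree at most `d`. -/
def ULow (d : ℕ) (h : F → K) : Prop := ∃ p : K[X], p.natDegree ≤ d ∧ ∀ t, h t = p.eval (ι t)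

variable {ι}

lemma ULow.mono {d e : ℕ} {h : F → K} (hd : ULow ι d h) (hde : d ≤ e) : ULow ι e h := by
  obtain ⟨p, hp, h1⟩ := hd
  exact ⟨p, hp.trans hde, h1⟩

lemma ULow.mul {d e : ℕ} {h k : F → K} (hh : ULow ι d h) (hk : ULow ι e k) :
    ULow ι (d + e) (fun t => h t * k t) := by
  obtain ⟨p, hp, h1⟩ := hh
  obtain ⟨r, hr, h2⟩ := hk
  exact ⟨p * r, natDegree_mul_le_of_le hp hr, fun t => by simp only [h1, h2, eval_mul]⟩

lemma ULow.sum {γ : Type*} (s : Finset γ) {d : ℕ} {h : γ → F → K} (hh : ∀ c ∈ s, ULow ι d (h c)) :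
    ULow ι d (fun t => ∑ c ∈ s, h c t) := by
  classical
  choose! p hp h1 using hh
  refine ⟨∑ c ∈ s, p c, natDegree_sum_le_of_forall_le _ _ hp, fun t => ?_⟩
  rw [eval_finsetSum]
  exact Finset.sum_congr rfl fun c hc => h1 c hc t

lemma ULow.const {d : ℕ} (k : K) : ULow ι d (fun _ => k) := ⟨C k, by simp, by simp⟩

lemma ULow.comp {d : ℕ} {h : F → K} (hh : ULow ι d h) (u v : F) :
    ULow ι d (fun t => h (u + t * v)) := by
  obtain ⟨p, hp, h1⟩ := hh
  refine ⟨p.comp (C (ι u) + X * C (ι v)), ?_, fun t => by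
    simp only [h1, eval_comp, eval_add, eval_mul, eval_C, eval_X, map_add, map_mul]⟩
  refine natDegree_comp_le.trans ?_
  have : (C (ι u) + X * C (ι v) : K[X]).natDegree ≤ 1 := by compute_degree
  calc _ ≤ p.natDegree * 1 := Nat.mul_le_mul_left _ this
    _ ≤ d := by omega

lemma poly_eq_of_cnt {D : ℕ} {p r : K[X]} (hp : p.natDegree ≤ D) (hr : r.natDegree ≤ D)
    (h : (D : ℝ) < cnt fun t : F => p.eval (ι t) = r.eval (ι t)) : p = r := by
  classical
  rw [cnt_eq_card] at h
  have h' : D < (Finset.univ.filter fun t : F => p.eval (ι t) = r.eval (ι t)).card := by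
    exact_mod_cast h
  rw [← Finset.card_map ⟨ι, ι.injective⟩] at h'
  refine eq_of_degree_sub_lt_of_eval_finset_eq (Finset.map ⟨ι, ι.injective⟩
    (Finset.univ.filter fun t : F => p.eval (ι t) = r.eval (ι t))) ?_ ?_
  · refine lt_of_le_of_lt degree_le_natDegree ?_
    have := natDegree_sub_le p r
    have h3 : (p - r).natDegree ≤ D := this.trans (max_le hp hr)
    exact_mod_cast h3.trans_lt h'
  · intro x hx
    simp only [Finset.mem_map, Finset.mem_filter, Finset.mem_univ, true_and,
      Function.Embedding.coeFn_mk] at hx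
    obtain ⟨t, ht, rfl⟩ := hx
    exact ht

lemma ULow.eq_of_cnt {D : ℕ} {h k : F → K} (hh : ULow ι D h) (hk : ULow ι D k)
    (hc : (D : ℝ) < cnt fun t : F => h t = k t) : ∀ t, h t = k t := by
  obtain ⟨p, hp, h1⟩ := hh
  obtain ⟨r, hr, h2⟩ := hk
  have : p = r := by
    apply poly_eq_of_cnt (ι := ι) hp hr
    simpa only [← h1, ← h2] using hc
  intro t
  rw [h1, h2, this]

open Classical in
/-- Lagrange basis function at node `c` in `s`. -/
noncomputable def lag (ι : F →+* K) (s : Finset F) (c : F) (t : F) : K :=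
  (Lagrange.basis s (fun x => ι x) c).eval (ι t)

lemma lag_low {d : ℕ} {s : Finset F} (hs : s.card = d + 1) {c : F} (hc : c ∈ s) :
    ULow ι d (lag ι s c) := by
  classical
  refine ⟨_, ?_, fun t => rfl⟩
  apply natDegree_le_of_degree_le
  have := Lagrange.degree_basis (s := s) (v := fun x => ι x) (i := c) ι.injective.injOn hc
  convert this.le
  simp [hs]

lemma lag_interp {d : ℕ} {s : Finset F} (hs : s.card = d + 1) {h : F → K} (hh : ULow ι d h)
    (t : F) : h t = ∑ c ∈ s, lag ι s c t * h c := by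
  classical
  obtain ⟨p, hp, h1⟩ := hh
  have hdeg : p.degree < s.card := by
    refine lt_of_le_of_lt degree_le_natDegree ?_
    rw [hs]; exact_mod_cast Nat.lt_succ_of_le hp
  have := Lagrange.eq_interpolate (s := s) (v := fun x => ι x) ι.injective.injOn hdeg
  rw [h1]
  conv_lhs => rw [this]
  rw [Lagrange.interpolate_apply, eval_finsetSum]
  refine Finset.sum_congr rfl fun c _ => ?_
  rw [eval_mul, eval_C, h1]
  simp only [lag]; ring

end low

section lines
variable {F K : Type} [Field F] [Fintype F] [Field K]
variable {V : Type} [AddCommGroup V] [Module F V]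

/-- `f` has degree at most `d` along `t ↦ a + t b`. -/
def Good (ι : F →+* K) (d : ℕ) (f : V → K) (a b : V) : Prop :=
  ULow ι d (fun t => f (a + t • b))

/-- `R` has degree at most `D` along all lines. -/
def LineDeg (ι : F →+* K) (D : ℕ) (R : V → K) : Prop := ∀ a b, Good ι D R a b

variable {ι : F →+* K} {d : ℕ} {f : V → K}

lemma good_zero (a : V) : Good ι d f a 0 := by
  simpa [Good] using ULow.const (ι := ι) (d := d) (f a)

lemma Good.shift {a b : V} (h : Good ι d f a b) (s : F) : Good ι d f (a + s • b) b := by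
  have := ULow.comp h s 1
  refine (congrArg (ULow ι d) ?_).mp this
  funext t
  simp only [mul_one, add_smul, add_assoc]

lemma good_shift_iff {a b : V} (s : F) : Good ι d f (a + s • b) b ↔ Good ι d f a b := by
  refine ⟨fun h => ?_, fun h => h.shift s⟩
  have := h.shift (-s)
  simpa [add_assoc] using this

lemma Good.scale {a b : V} (h : Good ι d f a b) (c : F) : Good ι d f a (c • b) := by
  have := ULow.comp h 0 c
  refine (congrArg (ULow ι d) ?_).mp this
  funext t
  simp only [zero_add, mul_smul]

lemma good_scale_iff {a b : V} {c : F} (hc : c ≠ 0) :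
    Good ι d f a (c • b) ↔ Good ι d f a b := by
  refine ⟨fun h => ?_, fun h => h.scale c⟩
  have := h.scale c⁻¹
  rwa [smul_smul, inv_mul_cancel₀ hc, one_smul] at this

lemma good_comp {V' : Type} [AddCommGroup V'] [Module F V'] (σ : V' →ₗ[F] V) (a b : V') :
    Good ι d (fun x => f (σ x)) a b ↔ Good ι d f (σ a) (σ b) := by
  simp [Good]

lemma LineDeg.comp {V' : Type} [AddCommGroup V'] [Module F V'] {D : ℕ} {R : V → K}
    (h : LineDeg ι D R) (σ : V' →ₗ[F] V) : LineDeg ι D (fun x => R (σ x)) :=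
  fun a b => (good_comp σ a b).2 (h _ _)

variable [Fintype V]

lemma sum_smul_left {M : Type*} [AddCommMonoid M] (φ : V → M) (x : V) {t : F} (ht : t ≠ 0) :
    ∑ b, φ (x + t • b) = ∑ b, φ b :=
  Fintype.sum_bijective (fun b : V => x + t • b)
    ⟨fun b c h => by simpa [ht] using h,
     fun y => ⟨t⁻¹ • (y - x), by simp [smul_smul, ht]⟩⟩ _ _ (fun _ => rfl)

lemma sum_add_right' {M : Type*} [AddCommMonoid M] (φ : V → M) (y : V) :
    ∑ a, φ (a + y) = ∑ b, φ b := Equiv.sum_comp (Equiv.addRight y) φ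

/-- Schwartz-Zippel for functions of low degree along lines. -/
lemma LineDeg.eq_of_cnt {D : ℕ} {R S : V → K} (hR : LineDeg ι D R) (hS : LineDeg ι D S)
    (h : (D : ℝ) * Fintype.card V < cnt (fun x => R x = S x) * (Fintype.card F - 1)) :
    ∀ x, R x = S x := by
  classical
  by_contra hn
  push Not at hn
  obtain ⟨x, hx⟩ := hn
  have h1 : ∀ b : V, cnt (fun t : F => R (x + t • b) = S (x + t • b)) ≤ D := by
    intro b
    by_contra hc
    push Not at hc
    have := ULow.eq_of_cnt (hR x b) (hS x b) hc 0
    simp at this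
    exact hx this
  have h2 : ∑ b : V, cnt (fun t : F => R (x + t • b) = S (x + t • b)) ≤ D * Fintype.card V := by
    refine (Finset.sum_le_sum fun b _ => h1 b).trans ?_
    simp [mul_comm]
  rw [cnt_comm] at h2
  have h3 : ∑ t ∈ Finset.univ.erase (0 : F), cnt (fun b : V => R (x + t • b) = S (x + t • b))
      = ∑ t ∈ Finset.univ.erase (0 : F), cnt (fun x => R x = S x) := by
    refine Finset.sum_congr rfl fun t ht => ?_
    exact sum_smul_left (fun y => ind (R y = S y)) x (Finset.ne_of_mem_erase ht)
  have h4 : ∑ t ∈ Finset.univ.erase (0 : F), cnt (fun b : V => R (x + t • b) = S (x + t • b))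
      ≤ ∑ t, cnt (fun b : V => R (x + t • b) = S (x + t • b)) :=
    Finset.sum_le_sum_of_subset_of_nonneg (Finset.erase_subset _ _) fun _ _ _ => cnt_nonneg _
  rw [h3, Finset.sum_const, Finset.card_erase_of_mem (Finset.mem_univ _), Finset.card_univ,
    nsmul_eq_mul, Nat.cast_sub Fintype.card_pos] at h4
  push_cast at h4
  linarith

/-- Each point is equally often on a line. -/
lemma sum_line (φ : V → ℝ) :
    ∑ p : V × V, ∑ t : F, φ (p.1 + t • p.2) = Fintype.card F * Fintype.card V * ∑ x, φ x := by
  rw [Finset.sum_comm]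
  have : ∀ t ∈ (Finset.univ : Finset F), ∑ p : V × V, φ (p.1 + t • p.2)
      = Fintype.card V * ∑ x, φ x := by
    intro t _
    rw [Fintype.sum_prod_type_right]
    rw [Finset.sum_congr rfl fun b _ => sum_add_right' φ (t • b)]
    simp
  rw [Finset.sum_congr rfl this]
  simp [mul_assoc]

lemma pair_sum_zero (φ : V → ℝ) (h0 : ∑ x, φ x = 0) {t t' : F} (ht : t ≠ t') :
    ∑ p : V × V, φ (p.1 + t • p.2) * φ (p.1 + t' • p.2) = 0 := by
  rw [Fintype.sum_prod_type_right]
  have h1 : ∀ b : V, ∑ a : V, φ (a + t • b) * φ (a + t' • b)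
      = ∑ a : V, φ a * φ (a + (t' - t) • b) := by
    intro b
    rw [← sum_add_right' (fun a => φ a * φ (a + (t' - t) • b)) (t • b)]
    refine Finset.sum_congr rfl fun a _ => ?_
    congr 2
    rw [sub_smul]; abel
  simp_rw [h1]
  rw [Finset.sum_comm]
  refine Finset.sum_eq_zero fun a _ => ?_
  rw [← Finset.mul_sum, sum_smul_left φ a (sub_ne_zero.2 ht.symm), h0, mul_zero]

/-- Second moment: if many lines avoid a set then the set is small. -/
lemma second_moment (A : V → Prop) :
    cnt (fun p : V × V => ∀ t : F, ¬ A (p.1 + t • p.2)) * Fintype.card F * cnt A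
      ≤ (Fintype.card V : ℝ) ^ 3 := by
  classical
  set N : ℝ := ((Fintype.card V : ℕ) : ℝ) with hN
  set q : ℝ := ((Fintype.card F : ℕ) : ℝ) with hq
  have hNpos : 0 < N := by
    have : 0 < Fintype.card V := Fintype.card_pos_iff.2 ⟨0⟩
    rw [hN]; exact_mod_cast this
  have hqpos : 0 < q := by
    have : 0 < Fintype.card F := Fintype.card_pos
    rw [hq]; exact_mod_cast this
  set α : ℝ := cnt A / N with hα
  set φ : V → ℝ := fun x => ind (A x) - α with hφ
  have hA0 : 0 ≤ cnt A := cnt_nonneg A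
  have h0 : ∑ x, φ x = 0 := by
    simp only [hφ, Finset.sum_sub_distrib, Finset.sum_const, Finset.card_univ, nsmul_eq_mul]
    change cnt A - N * α = 0
    rw [hα]; field_simp; ring
  have hsq : ∑ x, φ x * φ x ≤ cnt A := by
    have : ∀ x, φ x * φ x = ind (A x) - 2 * α * ind (A x) + α ^ 2 := by
      intro x
      simp only [hφ]
      have : ind (A x) * ind (A x) = ind (A x) := by unfold ind; split_ifs <;> norm_num
      linear_combination this
    simp_rw [this]
    rw [Finset.sum_add_distrib, Finset.sum_sub_distrib, ← Finset.mul_sum]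
    simp only [Finset.sum_const, Finset.card_univ, nsmul_eq_mul]
    change cnt A - 2 * α * cnt A + N * α ^ 2 ≤ cnt A
    have : N * α ^ 2 = α * cnt A := by rw [hα]; field_simp
    rw [this]
    have : 0 ≤ α * cnt A := by positivity
    linarith
  have hvar : ∑ p : V × V, (∑ t : F, φ (p.1 + t • p.2)) ^ 2 ≤ q * N * cnt A := by
    have e1 : ∀ p : V × V, (∑ t : F, φ (p.1 + t • p.2)) ^ 2
        = ∑ t : F, ∑ t' : F, φ (p.1 + t • p.2) * φ (p.1 + t' • p.2) := by
      intro p; rw [sq, Finset.sum_mul_sum]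
    simp_rw [e1]
    rw [Finset.sum_comm]
    have e2 : ∀ t : F, ∑ p : V × V, ∑ t' : F, φ (p.1 + t • p.2) * φ (p.1 + t' • p.2)
        = ∑ p : V × V, φ (p.1 + t • p.2) * φ (p.1 + t • p.2) := by
      intro t
      rw [Finset.sum_comm]
      rw [Finset.sum_eq_single t]
      · intro t' _ ht'
        exact pair_sum_zero φ h0 (Ne.symm ht')
      · simp
    simp_rw [e2]
    rw [Finset.sum_comm, sum_line (F := F) (fun x => φ x * φ x)]
    exact mul_le_mul_of_nonneg_left hsq (by positivity)
  have hm := markov (fun p : V × V => ∀ t : F, ¬ A (p.1 + t • p.2))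
    (fun p => (∑ t : F, φ (p.1 + t • p.2)) ^ 2) ((q * α) ^ 2) (fun _ => sq_nonneg _) (by
      intro p hp
      have : ∑ t : F, φ (p.1 + t • p.2) = - (q * α) := by
        simp only [hφ, ind_false (hp _)]
        simp [hq]
      rw [this]; exact le_of_eq (by ring))
  rcases hA0.eq_or_lt with hz | hpos
  · rw [← hz]; simp; positivity
  have h5 := hm.trans hvar
  rw [hα] at h5
  set Lc := cnt (fun p : V × V => ∀ t : F, ¬ A (p.1 + t • p.2))
  have h6 : Lc * q * cnt A * (q * cnt A) ≤ N ^ 3 * (q * cnt A) := by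
    have : Lc * (q * (cnt A / N)) ^ 2 * N ^ 2 ≤ q * N * cnt A * N ^ 2 :=
      mul_le_mul_of_nonneg_right h5 (by positivity)
    have e : Lc * (q * (cnt A / N)) ^ 2 * N ^ 2 = Lc * q * cnt A * (q * cnt A) := by
      field_simp
    rw [e] at this
    linarith
  exact le_of_mul_le_mul_right h6 (by positivity)

end lines

section step
variable {F K : Type} [Field F] [Fintype F] [Field K]

/-- The inductive claim: a function with many good lines agrees on many good lines with a function
of low degree along all lines. -/
def PV (ι : F →+* K) (d m : ℕ) (κ : ℝ) (V : Type) [AddCommGroup V] [Module F V] [Fintype V] :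
    Prop :=
  ∀ (f : V → K) (ε : ℝ), 0 < ε → ε ≤ 1 →
    ε * (Fintype.card V : ℝ) ^ 2 ≤ cnt (fun p : V × V => Good ι d f p.1 p.2) →
    (d : ℝ) + 1 ≤ κ * ε ^ 3 * Fintype.card F →
    ∃ R : V → K, LineDeg ι (m * d) R ∧
      ε / 2 * (Fintype.card V : ℝ) ^ 2 ≤ cnt (fun p : V × V => Good ι d f p.1 p.2 ∧
        ∀ t : F, f (p.1 + t • p.2) = R (p.1 + t • p.2))

variable {W : Type} [AddCommGroup W] [Module F W] [Fintype W] {ι : F →+* K} {d m : ℕ} {κ : ℝ}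

lemma plane_bound (g R : W → K) {ε T : ℝ} (hε : 0 < ε)
    (hT : T ≤ ε ^ 3 * Fintype.card F / 800)
    (h : ε / 4 * (Fintype.card W : ℝ) ^ 2 ≤ cnt (fun p : W × W => Good ι d g p.1 p.2 ∧
        ∀ t : F, g (p.1 + t • p.2) = R (p.1 + t • p.2))) :
    T * cnt (fun x => g x ≠ R x) ≤ ε ^ 2 / 200 * Fintype.card W := by
  have h1 := second_moment (F := F) (fun x => g x ≠ R x)
  have h2 : cnt (fun p : W × W => Good ι d g p.1 p.2 ∧
        ∀ t : F, g (p.1 + t • p.2) = R (p.1 + t • p.2)) ≤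
      cnt (fun p : W × W => ∀ t : F, ¬ (g (p.1 + t • p.2) ≠ R (p.1 + t • p.2))) :=
    cnt_mono fun p hp t => not_not.2 (hp.2 t)
  have h3 := h.trans h2
  set Lc := cnt (fun p : W × W => ∀ t : F, ¬ (g (p.1 + t • p.2) ≠ R (p.1 + t • p.2)))
  set A := cnt (fun x => g x ≠ R x)
  have hA : 0 ≤ A := cnt_nonneg _
  have hw : (0 : ℝ) < Fintype.card W := by
    have : 0 < Fintype.card W := Fintype.card_pos_iff.2 ⟨0⟩
    exact_mod_cast this
  have hq : (0 : ℝ) < Fintype.card F := by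
    have : 0 < Fintype.card F := Fintype.card_pos
    exact_mod_cast this
  generalize (Fintype.card W : ℝ) = w at *
  generalize (Fintype.card F : ℝ) = q at *
  have h4 : w ^ 2 * (ε * q * A) ≤ w ^ 2 * (4 * w) := by
    have : ε / 4 * w ^ 2 * (q * A) ≤ Lc * (q * A) :=
      mul_le_mul_of_nonneg_right h3 (by positivity)
    nlinarith
  have h5 : ε * q * A ≤ 4 * w := le_of_mul_le_mul_left h4 (by positivity)
  calc T * A ≤ ε ^ 3 * q / 800 * A := mul_le_mul_of_nonneg_right hT hA
    _ = ε ^ 2 / 800 * (ε * q * A) := by ring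
    _ ≤ ε ^ 2 / 800 * (4 * w) := mul_le_mul_of_nonneg_left h5 (by positivity)
    _ = _ := by ring

set_option maxHeartbeats 2000000 in
lemma core (hP : PV ι d m κ W) (hκ : κ ≤ 1 / 100) (hm : m ≤ 2) (f : F × W → K)
    (ε : ℝ) (hε0 : 0 < ε) (hε1 : ε ≤ 1)
    (hG : ε * (Fintype.card (F × W) : ℝ) ^ 2 ≤
      cnt fun p : (F × W) × (F × W) => Good ι d f p.1 p.2)
    (hX : ε / 2 * Fintype.card W ≤ cnt fun x : W => Good ι d f (0, x) (1, 0))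
    (hY : ε * Fintype.card F * (Fintype.card W : ℝ) ^ 2 ≤
      ∑ c : F, cnt fun p : W × W => Good ι d (fun x => f (c, x)) p.1 p.2)
    (hd : (d : ℝ) + 1 ≤ κ / 8 * ε ^ 3 * Fintype.card F) :
    ∃ R : F × W → K, LineDeg ι ((m + 1) * d) R ∧
      ε / 2 * (Fintype.card (F × W) : ℝ) ^ 2 ≤ cnt (fun p : (F × W) × (F × W) =>
        Good ι d f p.1 p.2 ∧ ∀ t : F, f (p.1 + t • p.2) = R (p.1 + t • p.2)) := by
  classical
  have hw : (0 : ℝ) < Fintype.card W := by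
    have : 0 < Fintype.card W := Fintype.card_pos_iff.2 ⟨0⟩
    exact_mod_cast this
  have hq : (0 : ℝ) < Fintype.card F := by
    have : 0 < Fintype.card F := Fintype.card_pos
    exact_mod_cast this
  have hN : (Fintype.card (F × W) : ℝ) = Fintype.card F * Fintype.card W := by
    rw [Fintype.card_prod]; push_cast; ring
  set q : ℝ := ((Fintype.card F : ℕ) : ℝ) with hqdef
  set w : ℝ := ((Fintype.card W : ℕ) : ℝ) with hwdef
  set T : ℝ := (d : ℝ) + 1 with hTdef
  have hT1 : 1 ≤ T := by have : (0 : ℝ) ≤ d := Nat.cast_nonneg d; linarith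
  have hcubeq : 0 < ε ^ 3 * q := by positivity
  have hT : T ≤ ε ^ 3 * q / 800 := by nlinarith
  have hε2 : ε ^ 2 ≤ ε := by nlinarith
  have hTq : T ≤ ε * q / 800 := by
    have : ε ^ 3 * q ≤ ε * q := mul_le_mul_of_nonneg_right (by nlinarith) hq.le
    linarith
  -- good planes
  set C : Finset F := Finset.univ.filter fun c =>
    ε / 2 * w ^ 2 ≤ cnt fun p : W × W => Good ι d (fun x => f (c, x)) p.1 p.2 with hC
  have hCcard : ε / 2 * q ≤ C.card := by
    have h1 : ∀ c : F, (cnt fun p : W × W => Good ι d (fun x => f (c, x)) p.1 p.2) ≤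
        (if c ∈ C then w ^ 2 else 0) + ε / 2 * w ^ 2 := by
      intro c
      split_ifs with hc
      · have := cnt_le_card fun p : W × W => Good ι d (fun x => f (c, x)) p.1 p.2
        rw [Fintype.card_prod] at this
        push_cast at this
        rw [← hwdef] at this
        nlinarith [sq_nonneg w]
      · simp only [hC, Finset.mem_filter, Finset.mem_univ, true_and, not_le] at hc
        linarith
    have h2 := hY.trans (Finset.sum_le_sum fun c _ => h1 c)
    rw [Finset.sum_add_distrib, Finset.sum_const, Finset.card_univ, nsmul_eq_mul, ← hqdef,
      Finset.sum_ite_mem, Finset.univ_inter, Finset.sum_const, nsmul_eq_mul] at h2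
    have h3 : ε / 2 * q * w ^ 2 ≤ C.card * w ^ 2 := by linarith
    exact le_of_mul_le_mul_right h3 (by positivity)
  have hRc : ∀ c ∈ C, ∃ R : W → K, LineDeg ι (m * d) R ∧
      T * cnt (fun x => f (c, x) ≠ R x) ≤ ε ^ 2 / 200 * w := by
    intro c hc
    simp only [hC, Finset.mem_filter, Finset.mem_univ, true_and] at hc
    obtain ⟨R, hR, hcnt⟩ := hP (fun x => f (c, x)) (ε / 2) (by positivity) (by linarith) hc
      (by rw [← hTdef, ← hqdef]; calc T ≤ _ := hd
            _ = _ := by ring)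
    refine ⟨R, hR, plane_bound (ι := ι) (d := d) (fun x => f (c, x)) R hε0 hT ?_⟩
    refine le_trans (le_of_eq ?_) hcnt
    rw [← hwdef]; ring
  choose! Rc hRl hRa using hRc
  have hRa1 : ∀ c ∈ C, cnt (fun x => f (c, x) ≠ Rc c x) ≤ ε ^ 2 / 200 * w := by
    intro c hc
    have := hRa c hc
    have h0 := cnt_nonneg (fun x => f (c, x) ≠ Rc c x)
    nlinarith
  obtain ⟨C0, hC0C, hC0⟩ : ∃ C0 ⊆ C, C0.card = d + 1 := by
    apply Finset.exists_subset_card_eq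
    have : ((d + 1 : ℕ) : ℝ) ≤ C.card := by
      push_cast
      have : 0 < ε * q := by positivity
      linarith
    exact_mod_cast this
  set R : F × W → K := fun p => ∑ c ∈ C0, lag ι C0 c p.1 * Rc c p.2 with hR
  have hRlow : LineDeg ι ((m + 1) * d) R := by
    intro a b
    change ULow ι _ (fun t => ∑ c ∈ C0, lag ι C0 c (a.1 + t * b.1) * Rc c (a.2 + t • b.2))
    refine ULow.sum C0 fun c hc => ?_
    have := ((lag_low (ι := ι) hC0 hc).comp a.1 b.1).mul (hRl c (hC0C hc) a.2 b.2)
    exact this.mono (le_of_eq (by ring))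
  have hagree : ∀ c ∈ C, ∀ x, R (c, x) = Rc c x := by
    intro c hc
    refine LineDeg.eq_of_cnt (ι := ι) (D := m * d) ?_ (hRl c hc) ?_
    · intro a b
      change ULow ι _ (fun t => ∑ c' ∈ C0, lag ι C0 c' c * Rc c' (a + t • b))
      refine ULow.sum C0 fun c' hc' => ?_
      have := (ULow.const (ι := ι) (d := 0) (lag ι C0 c' c)).mul (hRl c' (hC0C hc') a b)
      exact this.mono (le_of_eq (by ring))
    · have h1 : (cnt fun x : W => Good ι d f (0, x) (1, 0)) ≤
          cnt (fun x => R (c, x) = Rc c x) +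
            cnt (fun x => ∃ c' ∈ insert c C0, f (c', x) ≠ Rc c' x) := by
        refine le_trans (cnt_mono ?_) (cnt_or_le _ _)
        intro x hx
        by_cases hbad : ∃ c' ∈ insert c C0, f (c', x) ≠ Rc c' x
        · exact Or.inr hbad
        · left
          push Not at hbad
          have hl : ULow ι d (fun s => f (s, x)) := by
            have h := hx
            unfold Good at h
            simpa using h
          rw [← hbad c (Finset.mem_insert_self _ _)]
          have := lag_interp hC0 hl c
          rw [this]
          refine Finset.sum_congr rfl fun c' hc' => ?_
          rw [hbad c' (Finset.mem_insert_of_mem hc')]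
      have h2 : cnt (fun x => ∃ c' ∈ insert c C0, f (c', x) ≠ Rc c' x) ≤ ε ^ 2 / 100 * w := by
        have hins : insert c C0 ⊆ C := Finset.insert_subset hc hC0C
        have hsum : ∑ c' ∈ insert c C0, T * cnt (fun x => f (c', x) ≠ Rc c' x) ≤
            ((insert c C0).card : ℝ) * (ε ^ 2 / 200 * w) := by
          refine (Finset.sum_le_sum fun c' hc' => hRa c' (hins hc')).trans ?_
          rw [Finset.sum_const, nsmul_eq_mul]
        have hcard : ((insert c C0).card : ℝ) ≤ 2 * T := by
          have : (insert c C0).card ≤ d + 2 := (Finset.card_insert_le _ _).trans (by omega)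
          have h' : ((insert c C0).card : ℝ) ≤ d + 2 := by exact_mod_cast this
          linarith
        rw [← Finset.mul_sum] at hsum
        have hle := cnt_exists_le (insert c C0) (fun c' x => f (c', x) ≠ Rc c' x)
        have hmul : T * cnt (fun x => ∃ c' ∈ insert c C0, f (c', x) ≠ Rc c' x) ≤
            T * (ε ^ 2 / 100 * w) := by
          calc _ ≤ T * ∑ c' ∈ insert c C0, cnt (fun x => f (c', x) ≠ Rc c' x) :=
                mul_le_mul_of_nonneg_left hle (by linarith)
            _ ≤ _ := hsum
            _ ≤ 2 * T * (ε ^ 2 / 200 * w) := mul_le_mul_of_nonneg_right hcard (by positivity)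
            _ = _ := by ring
        exact le_of_mul_le_mul_left hmul (by linarith)
      have h3 : ε / 4 * w ≤ cnt (fun x => R (c, x) = Rc c x) := by nlinarith
      have h4 : ((m * d : ℕ) : ℝ) ≤ 2 * T := by
        push_cast
        have : (m : ℝ) ≤ 2 := by exact_mod_cast hm
        have h0 : (0 : ℝ) ≤ d := Nat.cast_nonneg d
        nlinarith
      have hq2 : q / 2 ≤ q - 1 := by nlinarith
      calc ((m * d : ℕ) : ℝ) * w ≤ 2 * (ε * q / 800) * w := by
            refine mul_le_mul_of_nonneg_right ?_ hw.le
            linarith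
        _ < ε / 4 * w * (q / 2) := by
            have : 0 < ε * q * w := by positivity
            nlinarith
        _ ≤ ε / 4 * w * (q - 1) := mul_le_mul_of_nonneg_left hq2 (by positivity)
        _ ≤ _ := mul_le_mul_of_nonneg_right h3 (by linarith)
  -- the bad points
  set B : F × W → Prop := fun p => p.1 ∈ C ∧ f p ≠ R p with hB
  have hBcnt : cnt B ≤ ε ^ 2 / 200 * (q * w) := by
    rw [cnt_prod]
    have : ∀ c : F, cnt (fun x => B (c, x)) ≤ ε ^ 2 / 200 * w := by
      intro c
      by_cases hc : c ∈ C
      · refine le_trans (cnt_mono ?_) (hRa1 c hc)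
        intro x hx
        rw [← hagree c hc]; exact hx.2
      · have : cnt (fun x => B (c, x)) = 0 :=
          Finset.sum_eq_zero fun x _ => ind_false fun h => hc h.1
        rw [this]; positivity
    refine (Finset.sum_le_sum fun c _ => this c).trans (le_of_eq ?_)
    rw [Finset.sum_const, Finset.card_univ, nsmul_eq_mul, ← hqdef]; ring
  refine ⟨R, hRlow, ?_⟩
  set bad : (F × W) × (F × W) → Prop := fun p => Good ι d f p.1 p.2 ∧ p.2.1 ≠ 0 ∧
    ¬ ∀ t : F, f (p.1 + t • p.2) = R (p.1 + t • p.2) with hbad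
  have hbadcnt : cnt bad * (ε * q / 4) ≤ q * (q * w) * (ε ^ 2 / 200 * (q * w)) := by
    have h1 := markov bad (fun p => ∑ t : F, ind (B (p.1 + t • p.2))) (ε * q / 4)
      (fun p => Finset.sum_nonneg fun _ _ => ind_nonneg _) (by
        intro p hp
        obtain ⟨hg, hne, hnot⟩ := hp
        change _ ≤ cnt fun t : F => B (p.1 + t • p.2)
        have ha : cnt (fun t : F => f (p.1 + t • p.2) = R (p.1 + t • p.2)) ≤
            (((m + 1) * d : ℕ) : ℝ) := by
          by_contra hc
          push Not at hc
          refine hnot (ULow.eq_of_cnt (ι := ι) (hg.mono ?_) (hRlow p.1 p.2) hc)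
          exact Nat.le_mul_of_pos_left d (Nat.succ_pos m)
        have hb : cnt (fun t : F => p.1.1 + t * p.2.1 ∈ C) = C.card := by
          have e1 : cnt (fun t : F => p.1.1 + t * p.2.1 ∈ C) = cnt (fun t : F => t ∈ C) := by
            have := sum_smul_left (F := F) (V := F) (fun s => ind (s ∈ C)) p.1.1 hne
            simp only [smul_eq_mul] at this
            rw [cnt, cnt, ← this]
            exact Finset.sum_congr rfl fun t _ => by rw [mul_comm]
          rw [e1, cnt_eq_card]
          simp
        have hc : cnt (fun t : F => p.1.1 + t * p.2.1 ∈ C) ≤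
            cnt (fun t : F => B (p.1 + t • p.2)) +
            cnt (fun t : F => f (p.1 + t • p.2) = R (p.1 + t • p.2)) := by
          refine le_trans (cnt_mono ?_) (cnt_or_le _ _)
          intro t ht
          by_cases he : f (p.1 + t • p.2) = R (p.1 + t • p.2)
          · exact Or.inr he
          · exact Or.inl ⟨ht, he⟩
        have h4 : (((m + 1) * d : ℕ) : ℝ) ≤ 3 * T := by
          push_cast
          have : (m : ℝ) ≤ 2 := by exact_mod_cast hm
          have h0 : (0 : ℝ) ≤ d := Nat.cast_nonneg d
          nlinarith
        have : 0 < ε * q := by positivity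
        linarith)
    rw [sum_line (F := F) (fun x => ind (B x)), hN] at h1
    exact h1.trans (mul_le_mul_of_nonneg_left hBcnt (by positivity))
  have hbad2 : cnt bad ≤ ε / 50 * (q * w) ^ 2 := by
    have : cnt bad * (ε * q / 4) ≤ ε / 50 * (q * w) ^ 2 * (ε * q / 4) :=
      hbadcnt.trans (le_of_eq (by ring))
    exact le_of_mul_le_mul_right this (by positivity)
  have hhor : cnt (fun p : (F × W) × (F × W) => p.2.1 = 0) * q = (q * w) ^ 2 := by
    rw [cnt_prod]
    have : cnt (fun b : F × W => b.1 = 0) = w := by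
      rw [cnt_prod']
      have : ∀ x : W, cnt (fun s : F => s = 0) = 1 := by
        intro x
        rw [cnt, Finset.sum_eq_single 0]
        · exact ind_true rfl
        · intro b _ hb; exact ind_false hb
        · simp
      rw [Finset.sum_congr rfl fun x _ => this x]
      simp [hwdef]
    simp only [this]
    rw [Finset.sum_const, Finset.card_univ, nsmul_eq_mul, hN]
    ring
  have hhor2 : cnt (fun p : (F × W) × (F × W) => p.2.1 = 0) ≤ ε / 50 * (q * w) ^ 2 := by
    have h50 : 1 ≤ ε / 50 * q := by nlinarith
    have : cnt (fun p : (F × W) × (F × W) => p.2.1 = 0) * q ≤ ε / 50 * (q * w) ^ 2 * q := by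
      rw [hhor]
      have : 0 ≤ (q * w) ^ 2 := by positivity
      nlinarith
    exact le_of_mul_le_mul_right this hq
  have htot : (cnt fun p : (F × W) × (F × W) => Good ι d f p.1 p.2) ≤
      cnt (fun p : (F × W) × (F × W) =>
        Good ι d f p.1 p.2 ∧ ∀ t : F, f (p.1 + t • p.2) = R (p.1 + t • p.2)) +
      (cnt bad + cnt (fun p : (F × W) × (F × W) => p.2.1 = 0)) := by
    refine le_trans (le_trans (cnt_mono ?_) (cnt_or_le _
      (fun p => bad p ∨ p.2.1 = 0))) (add_le_add le_rfl (cnt_or_le _ _))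
    intro p hp
    by_cases h0 : p.2.1 = 0
    · exact Or.inr (Or.inr h0)
    by_cases hl : ∀ t : F, f (p.1 + t • p.2) = R (p.1 + t • p.2)
    · exact Or.inl ⟨hp, hl⟩
    · exact Or.inr (Or.inl ⟨hp, h0, hl⟩)
  rw [hN] at hG ⊢
  have : 0 ≤ ε * (q * w) ^ 2 := by positivity
  linarith

end step

section coord
variable {F K : Type} [Field F] [Fintype F] [Field K]
variable {W : Type} [AddCommGroup W] [Module F W] [Fintype W] {ι : F →+* K} {d m : ℕ} {κ : ℝ}

lemma cnt_good_comp {V V' : Type} [AddCommGroup V] [Module F V] [Fintype V] [AddCommGroup V']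
    [Module F V'] [Fintype V'] (σ : V' ≃ₗ[F] V) (f : V → K) :
    cnt (fun p : V' × V' => Good ι d (fun x => f (σ x)) p.1 p.2) =
      cnt (fun p : V × V => Good ι d f p.1 p.2) := by
  rw [← cnt_equiv (Equiv.prodCongr σ.toEquiv σ.toEquiv)]
  refine cnt_congr fun p => ?_
  exact good_comp σ.toLinearMap p.1 p.2

/-- Transfer the conclusion along a linear equivalence. -/
lemma transfer {V V' : Type} [AddCommGroup V] [Module F V] [Fintype V] [AddCommGroup V']
    [Module F V'] [Fintype V'] (σ : V' ≃ₗ[F] V) (f : V → K) (D : ℕ) (c : ℝ)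
    (h : ∃ R : V' → K, LineDeg ι D R ∧ c ≤ cnt (fun p : V' × V' =>
      Good ι d (fun x => f (σ x)) p.1 p.2 ∧
        ∀ t : F, f (σ (p.1 + t • p.2)) = R (p.1 + t • p.2))) :
    ∃ R : V → K, LineDeg ι D R ∧ c ≤ cnt (fun p : V × V =>
      Good ι d f p.1 p.2 ∧ ∀ t : F, f (p.1 + t • p.2) = R (p.1 + t • p.2)) := by
  obtain ⟨R, hR, hc⟩ := h
  refine ⟨fun x => R (σ.symm x), hR.comp σ.symm.toLinearMap, hc.trans (le_of_eq ?_)⟩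
  rw [← cnt_equiv (Equiv.prodCongr σ.toEquiv σ.toEquiv)]
  refine cnt_congr fun p => and_congr (good_comp σ.toLinearMap p.1 p.2) ?_
  simp

lemma PV.congr {V V' : Type} [AddCommGroup V] [Module F V] [Fintype V] [AddCommGroup V']
    [Module F V'] [Fintype V'] (σ : V' ≃ₗ[F] V) (h : PV ι d m κ V') : PV ι d m κ V := by
  intro f ε h0 h1 hc hd
  have hcard : Fintype.card V' = Fintype.card V := Fintype.card_congr σ.toEquiv
  refine transfer σ f _ _ ?_
  rw [← hcard] at hc ⊢
  exact h (fun x => f (σ x)) ε h0 h1 (by rw [cnt_good_comp]; exact hc) hd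

lemma dual_sum (Λ : Type) [Fintype Λ] (e : Λ ≃ (W →ₗ[F] F)) (x : W) (hx : x ≠ 0) (φ : F → ℝ) :
    Fintype.card F * ∑ l, φ (e l x) = Fintype.card Λ * ∑ s, φ s := by
  obtain ⟨μ, hμ⟩ : ∃ μ : W →ₗ[F] F, μ x = 1 := by
    obtain ⟨μ, hμ⟩ : ∃ μ : W →ₗ[F] F, μ x ≠ 0 := by
      by_contra h
      push Not at h
      exact hx ((Module.forall_dual_apply_eq_zero_iff F x).1 h)
    exact ⟨(μ x)⁻¹ • μ, by simp [hμ]⟩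
  have h1 : ∀ s : F, ∑ l, φ (e l x) = ∑ l, φ (s + e l x) := by
    intro s
    have e2 := Equiv.sum_comp ((e.trans (Equiv.addLeft (s • μ))).trans e.symm)
      (fun l => φ (e l x))
    rw [← e2]
    refine Finset.sum_congr rfl fun l _ => ?_
    simp [hμ]
  have h2 : ∑ s : F, ∑ l, φ (e l x) = ∑ s : F, ∑ l, φ (s + e l x) :=
    Finset.sum_congr rfl fun s _ => h1 s
  rw [Finset.sum_comm (f := fun s l => φ (s + e l x))] at h2
  have h3 : ∀ l, ∑ s : F, φ (s + e l x) = ∑ s, φ s := fun l =>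
    Equiv.sum_comp (Equiv.addRight (e l x)) φ
  simp only [h3] at h2
  simpa using h2

lemma exists_hyperplane (f : F × W → K) (ε : ℝ)
    (hG : ε * (Fintype.card (F × W) : ℝ) ^ 2 ≤
      cnt fun p : (F × W) × (F × W) => Good ι d f p.1 p.2) :
    ∃ l : W →ₗ[F] F, ε * Fintype.card (F × W) * Fintype.card W ≤
      cnt fun p : (F × W) × W => Good ι d f p.1 (l p.2, p.2) := by
  classical
  have : Finite (W →ₗ[F] F) := DFunLike.finite _
  have : Fintype (W →ₗ[F] F) := Fintype.ofFinite _
  have hq : (0 : ℝ) < Fintype.card F := by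
    have : 0 < Fintype.card F := Fintype.card_pos
    exact_mod_cast this
  have hN : (Fintype.card (F × W) : ℝ) = Fintype.card F * Fintype.card W := by
    rw [Fintype.card_prod]; push_cast; ring
  apply exists_ge_of_sum
  have h1 : ∀ (a : F × W) (x : W),
      Fintype.card (W →ₗ[F] F) * ∑ s : F, ind (Good ι d f a (s, x)) ≤
      Fintype.card F * ∑ l : W →ₗ[F] F, ind (Good ι d f a (l x, x)) := by
    intro a x
    by_cases hx : x = 0
    · subst hx
      have : ∀ l : W →ₗ[F] F, ind (Good ι d f a (l 0, 0)) = 1 := by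
        intro l
        apply ind_true
        rw [map_zero]
        exact good_zero a
      simp only [this]
      have h2 := cnt_le_card fun s : F => Good ι d f a (s, 0)
      change _ * cnt (fun s : F => Good ι d f a (s, 0)) ≤ _
      simp only [Finset.sum_const, Finset.card_univ, nsmul_eq_mul, mul_one]
      rw [mul_comm (Fintype.card F : ℝ)]
      exact mul_le_mul_of_nonneg_left h2 (by positivity)
    · exact le_of_eq (dual_sum (W →ₗ[F] F) (Equiv.refl _) x hx
        (fun s => ind (Good ι d f a (s, x)))).symm
  have h2 : (Fintype.card (W →ₗ[F] F) : ℝ) *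
      (cnt fun p : (F × W) × (F × W) => Good ι d f p.1 p.2) ≤
      Fintype.card F * ∑ l : W →ₗ[F] F, cnt fun p : (F × W) × W => Good ι d f p.1 (l p.2, p.2) := by
    rw [cnt_comm (fun (l : W →ₗ[F] F) (p : (F × W) × W) => Good ι d f p.1 (l p.2, p.2)),
      Fintype.sum_prod_type, cnt_prod]
    simp only [cnt_prod']
    rw [Finset.mul_sum, Finset.mul_sum]
    refine Finset.sum_le_sum fun a _ => ?_
    rw [Finset.mul_sum, Finset.mul_sum]
    exact Finset.sum_le_sum fun x _ => h1 a x
  have h3 : (Fintype.card (W →ₗ[F] F) : ℝ) * (ε * (Fintype.card (F × W) : ℝ) ^ 2) ≤ _ :=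
    (mul_le_mul_of_nonneg_left hG (by positivity)).trans h2
  rw [hN] at h3 ⊢
  refine le_of_mul_le_mul_left (le_trans (le_of_eq ?_) h3) hq
  ring

lemma exists_vertical (f : F × W → K) (ε : ℝ) (hε : 2 ≤ ε * Fintype.card F)
    (hG : ε * (Fintype.card (F × W) : ℝ) ^ 2 ≤
      cnt fun p : (F × W) × (F × W) => Good ι d f p.1 p.2) :
    ∃ v : W, ε / 2 * Fintype.card (F × W) ≤ cnt fun a : F × W => Good ι d f a (1, v) := by
  classical
  have hq : (1 : ℝ) ≤ Fintype.card F := by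
    have : 0 < Fintype.card F := Fintype.card_pos
    exact_mod_cast this
  have hN : (Fintype.card (F × W) : ℝ) = Fintype.card F * Fintype.card W := by
    rw [Fintype.card_prod]; push_cast; ring
  have hw : (0 : ℝ) < Fintype.card W := by
    have : 0 < Fintype.card W := Fintype.card_pos_iff.2 ⟨0⟩
    exact_mod_cast this
  apply exists_ge_of_sum
  set Z := ∑ v : W, cnt fun a : F × W => Good ι d f a (1, v) with hZ
  have hZ0 : 0 ≤ Z := Finset.sum_nonneg fun _ _ => cnt_nonneg _
  have h1 : (cnt fun p : (F × W) × (F × W) => Good ι d f p.1 p.2) ≤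
      Fintype.card F * Z + Fintype.card W * Fintype.card (F × W) := by
    rw [cnt_prod', Fintype.sum_prod_type]
    rw [← Finset.add_sum_erase _ _ (Finset.mem_univ (0 : F))]
    have e1 : ∑ s ∈ Finset.univ.erase (0 : F), ∑ x : W, cnt (fun a => Good ι d f a (s, x))
        ≤ Fintype.card F * Z := by
      have : ∀ s ∈ Finset.univ.erase (0 : F), ∑ x : W, cnt (fun a => Good ι d f a (s, x)) = Z := by
        intro s hs
        have hs0 := Finset.ne_of_mem_erase hs
        have := sum_smul_left (F := F) (fun x : W => cnt (fun a => Good ι d f a (s, x))) 0 hs0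
        rw [← this, hZ]
        refine Finset.sum_congr rfl fun v _ => cnt_congr fun a => ?_
        rw [← good_scale_iff hs0 (b := ((1 : F), v))]
        simp
      rw [Finset.sum_congr rfl this, Finset.sum_const, nsmul_eq_mul]
      refine mul_le_mul_of_nonneg_right ?_ hZ0
      exact_mod_cast (Finset.card_le_univ _)
    have e2 : ∑ x : W, cnt (fun a => Good ι d f a ((0 : F), x)) ≤
        Fintype.card W * Fintype.card (F × W) := by
      refine (Finset.sum_le_sum fun x _ => cnt_le_card _).trans ?_
      simp
    linarith
  have h2 := hG.trans h1
  rw [hN] at h2 ⊢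
  generalize (Fintype.card W : ℝ) = w at *
  generalize (Fintype.card F : ℝ) = q at *
  refine le_of_mul_le_mul_left (a := q) ?_ (by linarith)
  have h3 : 2 * (q * w ^ 2) ≤ ε * q * (q * w ^ 2) :=
    mul_le_mul_of_nonneg_right hε (by positivity)
  nlinarith

/-- Shear in the first coordinate. -/
def shear1 (l : W →ₗ[F] F) : (F × W) ≃ₗ[F] (F × W) where
  toFun p := (p.1 + l p.2, p.2)
  map_add' p r := by ext <;> simp; abel
  map_smul' c p := by ext <;> simp [mul_add]
  invFun p := (p.1 - l p.2, p.2)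
  left_inv p := by ext <;> simp
  right_inv p := by ext <;> simp

/-- Shear in the second coordinate. -/
def shear2 (v : W) : (F × W) ≃ₗ[F] (F × W) where
  toFun p := (p.1, p.2 + p.1 • v)
  map_add' p r := by ext <;> simp [add_smul]; abel
  map_smul' c p := by ext <;> simp [mul_smul]
  invFun p := (p.1, p.2 - p.1 • v)
  left_inv p := by ext <;> simp
  right_inv p := by ext <;> simp

lemma PV.step (hP : PV ι d m κ W) (hκ : κ ≤ 1 / 100) (hm : m ≤ 2) :
    PV ι d (m + 1) (κ / 8) (F × W) := by
  intro f ε hε0 hε1 hG hd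
  have hN : (Fintype.card (F × W) : ℝ) = Fintype.card F * Fintype.card W := by
    rw [Fintype.card_prod]; push_cast; ring
  have hq : (0 : ℝ) < Fintype.card F := by
    have : 0 < Fintype.card F := Fintype.card_pos
    exact_mod_cast this
  have hεq : 2 ≤ ε * Fintype.card F := by
    have h0 : (0 : ℝ) ≤ d := Nat.cast_nonneg d
    have h1 : 0 < ε ^ 3 * Fintype.card F := by positivity
    have h2 : ε ^ 3 * Fintype.card F ≤ ε * Fintype.card F :=
      mul_le_mul_of_nonneg_right (pow_le_of_le_one hε0.le hε1 (by norm_num)) hq.le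
    nlinarith
  obtain ⟨l, hl⟩ := exists_hyperplane f ε hG
  have hG1 : ε * (Fintype.card (F × W) : ℝ) ^ 2 ≤
      cnt fun p : (F × W) × (F × W) => Good ι d (fun x => f (shear1 l x)) p.1 p.2 := by
    rw [cnt_good_comp]; exact hG
  obtain ⟨v, hv⟩ := exists_vertical (fun x => f (shear1 l x)) ε hεq hG1
  have hG2 : ε * (Fintype.card (F × W) : ℝ) ^ 2 ≤
      cnt fun p : (F × W) × (F × W) =>
        Good ι d (fun x => f (shear1 l (shear2 v x))) p.1 p.2 := by
    rw [cnt_good_comp (shear2 v) (fun x => f (shear1 l x))]; exact hG1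
  refine transfer ((shear2 v).trans (shear1 l)) f _ _ ?_
  refine core hP hκ hm (fun x => f (shear1 l (shear2 v x))) ε hε0 hε1 hG2 ?_ ?_ hd
  · have e1 : (cnt fun a : F × W => Good ι d (fun x => f (shear1 l x)) a (1, v)) =
        Fintype.card F * cnt fun x : W =>
          Good ι d (fun x => f (shear1 l (shear2 v x))) (0, x) (1, 0) := by
      rw [← cnt_equiv (shear2 v).toEquiv, cnt_prod]
      have : ∀ s : F, (cnt fun x : W => Good ι d (fun x => f (shear1 l x))
          ((shear2 v).toEquiv (s, x)) (1, v)) = cnt fun x : W =>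
          Good ι d (fun x => f (shear1 l (shear2 v x))) (0, x) (1, 0) := by
        intro s
        refine cnt_congr fun x => ?_
        rw [← good_shift_iff s (a := ((0 : F), x))]
        have g := good_comp (ι := ι) (d := d) (f := fun x => f (shear1 l x))
          (shear2 v).toLinearMap (((0 : F), x) + s • ((1 : F), (0 : W))) ((1 : F), (0 : W))
        refine Iff.trans ?_ g.symm
        simp [shear2]
      simp only [this]
      simp
    rw [e1, hN] at hv
    refine le_of_mul_le_mul_left (le_trans (le_of_eq ?_) hv) hq
    ring
  · rw [hN] at hl
    refine le_trans (le_of_eq (by ring)) (hl.trans (le_of_eq ?_))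
    rw [← cnt_equiv (Equiv.prodCongr ((shear2 v).trans (shear1 l)).toEquiv (Equiv.refl W)),
      cnt_prod, Fintype.sum_prod_type]
    refine Finset.sum_congr rfl fun c _ => ?_
    rw [cnt_prod]
    refine Finset.sum_congr rfl fun x _ => cnt_congr fun y => ?_
    have : Good ι d (fun x => f (shear1 l (shear2 v x))) (c, x) (0, y) ↔
        Good ι d (fun x => f (shear1 l (shear2 v (c, x)))) x y := by
      simp [Good]
    have g := good_comp (ι := ι) (d := d) (f := f)
      ((shear2 v).trans (shear1 l)).toLinearMap (c, x) ((0 : F), y)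
    rw [← this]
    refine Iff.trans ?_ g.symm
    simp [shear1, shear2]

lemma PV_fin (ι : F →+* K) (d : ℕ) : ∀ n : ℕ, n ≤ 3 →
    PV ι d n (1 / 100 / 8 ^ n) (Fin n → F)
  | 0, _ => by
    intro f ε h0 h1 hG hd
    refine ⟨f, fun a b => ?_, ?_⟩
    · rw [Subsingleton.elim b 0]; exact good_zero a
    · refine le_trans ?_ (hG.trans (cnt_mono fun p hp => ⟨hp, fun _ => rfl⟩))
      exact mul_le_mul_of_nonneg_right (by linarith) (by positivity)
  | n + 1, hn => by
    have ih := PV_fin ι d n (by omega)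
    have h8 : (1 : ℝ) ≤ 8 ^ n := one_le_pow₀ (by norm_num)
    have := ih.step (by rw [div_le_iff₀ (by positivity)]; linarith) (by omega)
    have h2 := this.congr (Fin.consLinearEquiv F (fun _ : Fin (n + 1) => F))
    have e : (1 / 100 / 8 ^ n / 8 : ℝ) = 1 / 100 / 8 ^ (n + 1) := by
      rw [pow_succ]; field_simp
    rw [e] at h2
    exact h2

end coord

section final
open Polynomial
variable {F K : Type} [Field F] [Fintype F] [Field K]

lemma toMv (ι : F →+* K) {D : ℕ} (hD : D < Fintype.card F) : ∀ (n : ℕ) (R : (Fin n → F) → K),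
    LineDeg ι D R → ∃ P : MvPolynomial (Fin n) K, P.totalDegree ≤ n * D ∧
      ∀ x, R x = MvPolynomial.eval (fun i => ι (x i)) P
  | 0, R, _ => ⟨MvPolynomial.C (R 0), by simp, fun x => by
      rw [MvPolynomial.eval_C, Subsingleton.elim x 0]⟩
  | n + 1, R, hR => by
    classical
    obtain ⟨s, -, hs⟩ : ∃ s ⊆ (Finset.univ : Finset F), s.card = D + 1 :=
      Finset.exists_subset_card_eq (by rw [Finset.card_univ]; omega)
    have h1 : ∀ c : F, ∃ P : MvPolynomial (Fin n) K, P.totalDegree ≤ n * D ∧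
        ∀ x, R (Fin.cons c x) = MvPolynomial.eval (fun i => ι (x i)) P := by
      intro c
      refine toMv ι hD n (fun x => R (Fin.cons c x)) fun a b => ?_
      have := hR (Fin.cons c a) (Fin.cons 0 b)
      refine (congrArg (ULow ι D) ?_).mp this
      funext t
      congr 1
      ext i
      refine Fin.cases ?_ (fun j => ?_) i <;> simp
    choose P hP hPe using h1
    have h2 : ∀ c : F, ∃ r : K[X], c ∈ s → r.natDegree ≤ D ∧ ∀ t, lag ι s c t = r.eval (ι t) := by
      intro c
      by_cases hc : c ∈ s
      · obtain ⟨r, hr⟩ := lag_low (ι := ι) hs hc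
        exact ⟨r, fun _ => hr⟩
      · exact ⟨0, fun h => absurd h hc⟩
    choose r hr using h2
    refine ⟨∑ c ∈ s, Polynomial.aeval (MvPolynomial.X 0) (r c) *
      MvPolynomial.rename Fin.succ (P c), ?_, ?_⟩
    · refine MvPolynomial.totalDegree_finsetSum_le fun c hc => ?_
      refine (MvPolynomial.totalDegree_mul _ _).trans ?_
      have e1 : (Polynomial.aeval (MvPolynomial.X 0 : MvPolynomial (Fin (n + 1)) K)
          (r c)).totalDegree ≤ D := by
        rw [Polynomial.aeval_eq_sum_range]
        refine MvPolynomial.totalDegree_finsetSum_le fun i hi => ?_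
        refine (MvPolynomial.totalDegree_smul_le _ _).trans ?_
        rw [MvPolynomial.totalDegree_X_pow]
        have := (hr c hc).1
        have := Finset.mem_range.1 hi
        omega
      have e2 := (MvPolynomial.totalDegree_rename_le (Fin.succ : Fin n → Fin (n + 1)) (P c)).trans
        (hP c)
      calc _ ≤ D + n * D := add_le_add e1 e2
        _ = _ := by ring
    · intro x
      have hlow : ULow ι D (fun t => R (Fin.cons t (fun i => x i.succ))) := by
        have := hR (Fin.cons 0 (fun i => x i.succ)) (Fin.cons 1 0)
        refine (congrArg (ULow ι D) ?_).mp this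
        funext t
        congr 1
        ext i
        refine Fin.cases ?_ (fun j => ?_) i <;> simp
      have h3 := lag_interp hs hlow (x 0)
      have hx : (Fin.cons (x 0) (fun i => x i.succ) : Fin (n + 1) → F) = x := by
        ext i
        refine Fin.cases ?_ (fun j => ?_) i <;> simp
      rw [hx] at h3
      rw [h3, map_sum]
      refine Finset.sum_congr rfl fun c hc => ?_
      rw [map_mul, MvPolynomial.eval_rename, hPe, (hr c hc).2]
      congr 1
      rw [Polynomial.aeval_def, Polynomial.hom_eval₂]
      simp only [MvPolynomial.eval_X]
      rw [Polynomial.eval, ← Polynomial.eval₂_congr rfl rfl rfl]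
      congr 1
      ext k
      simp

/-- Restriction of a polynomial to a line. -/
noncomputable def linePoly {n : ℕ} (P : MvPolynomial (Fin n) K) (a b : Fin n → K) : K[X] :=
  ∑ k ∈ P.support, C (P.coeff k) * ∏ i, (C (a i) + X * C (b i)) ^ k i

lemma linePoly_eval {n : ℕ} (P : MvPolynomial (Fin n) K) (a b : Fin n → K) (t : K) :
    (linePoly P a b).eval t = MvPolynomial.eval (fun i => a i + t * b i) P := by
  rw [MvPolynomial.eval_eq', linePoly, eval_finsetSum]
  refine Finset.sum_congr rfl fun k _ => ?_
  simp only [eval_mul, eval_C, eval_prod, eval_pow, eval_add, eval_X]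

lemma prod_aux {n : ℕ} (a b : Fin n → K) (k : Fin n → ℕ) (s : Finset (Fin n)) :
    (∏ i ∈ s, (C (a i) + X * C (b i)) ^ k i).natDegree ≤ ∑ i ∈ s, k i ∧
    (∏ i ∈ s, (C (a i) + X * C (b i)) ^ k i).coeff (∑ i ∈ s, k i) = ∏ i ∈ s, b i ^ k i := by
  classical
  have hl : ∀ i, (C (a i) + X * C (b i)).natDegree ≤ 1 := fun i => by compute_degree
  have hp : ∀ i, ((C (a i) + X * C (b i)) ^ k i).natDegree ≤ k i := fun i => by
    have := natDegree_pow_le_of_le (k i) (hl i)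
    simpa using this
  induction s using Finset.induction_on with
  | empty => simp
  | insert j s hj ih =>
    rw [Finset.prod_insert hj, Finset.sum_insert hj, Finset.prod_insert hj]
    refine ⟨natDegree_mul_le_of_le (hp j) ih.1, ?_⟩
    rw [coeff_mul_add_eq_of_natDegree_le (hp j) ih.1, ih.2]
    congr 1
    have := coeff_pow_of_natDegree_le (m := k j) (hl j)
    rw [mul_one] at this
    rw [this]
    simp

lemma degree_le_total {n : ℕ} (P : MvPolynomial (Fin n) K) {k : Fin n →₀ ℕ} (hk : k ∈ P.support) :
    ∑ i, k i ≤ P.totalDegree := by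
  have := MvPolynomial.le_totalDegree hk
  rwa [Finsupp.sum_fintype _ _ (fun _ => rfl)] at this

lemma linePoly_natDegree {n : ℕ} (P : MvPolynomial (Fin n) K) (a b : Fin n → K) :
    (linePoly P a b).natDegree ≤ P.totalDegree := by
  refine natDegree_sum_le_of_forall_le _ _ fun k hk => ?_
  refine (natDegree_C_mul_le _ _).trans ?_
  exact ((prod_aux a b k Finset.univ).1).trans (degree_le_total P hk)

lemma linePoly_coeff {n : ℕ} (P : MvPolynomial (Fin n) K) (a b : Fin n → K) :
    (linePoly P a b).coeff P.totalDegree =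
      MvPolynomial.eval b (MvPolynomial.homogeneousComponent P.totalDegree P) := by
  classical
  rw [linePoly, finsetSum_coeff, MvPolynomial.homogeneousComponent_apply, map_sum,
    Finset.sum_filter]
  refine Finset.sum_congr rfl fun k hk => ?_
  rw [coeff_C_mul, MvPolynomial.eval_monomial, Finsupp.prod_fintype _ _ (fun _ => pow_zero _)]
  have hdeg : k.degree = ∑ i, k i := by
    rw [Finsupp.degree_eq_sum]
  obtain ⟨h1, h2⟩ := prod_aux a b k Finset.univ
  split_ifs with h
  · rw [← h, hdeg, h2]
  · rw [coeff_eq_zero_of_natDegree_lt, mul_zero]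
    have := degree_le_total P hk
    refine lt_of_le_of_lt h1 (lt_of_le_of_ne this ?_)
    rwa [hdeg] at h

lemma top_ne_zero {n : ℕ} {P : MvPolynomial (Fin n) K} (hP : P ≠ 0) :
    MvPolynomial.homogeneousComponent P.totalDegree P ≠ 0 := by
  classical
  intro h
  have hne : P.support.Nonempty := MvPolynomial.support_nonempty.2 hP
  obtain ⟨k, hk, hk2⟩ := Finset.exists_mem_eq_sup P.support hne
    (fun s : Fin n →₀ ℕ => s.sum fun _ e => e)
  have : MvPolynomial.coeff k (MvPolynomial.homogeneousComponent P.totalDegree P) =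
      MvPolynomial.coeff k P := by
    rw [MvPolynomial.coeff_homogeneousComponent, if_pos]
    rw [MvPolynomial.totalDegree, hk2, Finsupp.degree_eq_sum, Finsupp.sum_fintype _ _ (fun _ => rfl)]
  rw [h, MvPolynomial.coeff_zero] at this
  exact (MvPolynomial.mem_support_iff.1 hk) this.symm

lemma sz (ι : F →+* K) {n : ℕ} {H : MvPolynomial (Fin n) K} (hH : H ≠ 0) :
    (cnt fun b : Fin n → F => MvPolynomial.eval (fun i => ι (b i)) H = 0) * Fintype.card F ≤
      H.totalDegree * (Fintype.card (Fin n → F) : ℝ) := by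
  classical
  have hq : (0 : ℝ) < Fintype.card F := by
    have : 0 < Fintype.card F := Fintype.card_pos
    exact_mod_cast this
  have h := MvPolynomial.schwartz_zippel_totalDegree hH (Finset.univ.map ⟨ι, ι.injective⟩)
  rw [Finset.card_map, Finset.card_univ] at h
  have hle : (Finset.univ.filter fun b : Fin n → F =>
      MvPolynomial.eval (fun i => ι (b i)) H = 0).card ≤
      ((Fintype.piFinset fun _ : Fin n => Finset.univ.map ⟨ι, ι.injective⟩).filter
        fun f => MvPolynomial.eval f H = 0).card := by
    refine Finset.card_le_card_of_injOn (fun b i => ι (b i)) ?_ ?_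
    · intro b hb
      simp only [Finset.coe_filter, Finset.mem_univ, true_and, Set.mem_setOf_eq] at hb
      simp [hb]
    · intro b _ c _ hbc
      ext i
      exact ι.injective (congrFun hbc i)
  rw [cnt_eq_card]
  have h' := (NNRat.cast_le (K := ℝ)).2 h
  push_cast at h'
  rw [div_le_div_iff₀ (by positivity) hq] at h'
  have hN : (Fintype.card (Fin n → F) : ℝ) = (Fintype.card F : ℝ) ^ n := by
    simp
  rw [hN]
  refine le_trans (mul_le_mul_of_nonneg_right ?_ hq.le) h'
  exact_mod_cast hle

lemma deg_reduce (ι : F →+* K) {n d : ℕ} (P : MvPolynomial (Fin n) K)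
    (hlt : P.totalDegree < Fintype.card F)
    (h : (P.totalDegree : ℝ) * (Fintype.card (Fin n → F) : ℝ) <
      (cnt fun b : Fin n → F => ∃ a,
        Good ι d (fun x => MvPolynomial.eval (fun i => ι (x i)) P) a b) * Fintype.card F) :
    P.totalDegree ≤ d := by
  by_contra hd
  push Not at hd
  have hP : P ≠ 0 := by
    rintro rfl
    simp at hd
  have h1 := sz ι (top_ne_zero hP)
  have h2 := (MvPolynomial.homogeneousComponent_isHomogeneous P.totalDegree P).totalDegree_le
  have h3 : (cnt fun b : Fin n → F => ∃ a,
        Good ι d (fun x => MvPolynomial.eval (fun i => ι (x i)) P) a b) ≤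
      cnt fun b : Fin n → F => MvPolynomial.eval (fun i => ι (b i))
        (MvPolynomial.homogeneousComponent P.totalDegree P) = 0 := by
    refine cnt_mono fun b hb => ?_
    obtain ⟨a, p, hp, hpe⟩ := hb
    rw [← linePoly_coeff P (fun i => ι (a i))]
    have : linePoly P (fun i => ι (a i)) (fun i => ι (b i)) = p := by
      refine poly_eq_of_cnt (ι := ι) (linePoly_natDegree _ _ _) (hp.trans hd.le) ?_
      have : ∀ t : F, (linePoly P (fun i => ι (a i)) (fun i => ι (b i))).eval (ι t) =
          p.eval (ι t) := by
        intro t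
        rw [← hpe, linePoly_eval]
        simp
      simp only [this]
      have e : cnt (fun _ : F => True) = Fintype.card F := by
        simp [cnt, ind]
      simp only [e]
      exact_mod_cast hlt
    rw [this]
    exact coeff_eq_zero_of_natDegree_lt (lt_of_le_of_lt hp hd)
  have h4 : (0 : ℝ) ≤ Fintype.card F := by positivity
  have h5 : ((MvPolynomial.homogeneousComponent P.totalDegree P).totalDegree : ℝ) ≤
      P.totalDegree := by exact_mod_cast h2
  have h6 := mul_le_mul_of_nonneg_right h3 h4
  have h7 := mul_le_mul_of_nonneg_right h5
    (show (0 : ℝ) ≤ (Fintype.card (Fin n → F) : ℝ) by positivity)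
  linarith

end final

section fin3
variable {F K : Type} [Field F] [Fintype F] [Field K]

lemma card_pos' {V : Type} [Fintype V] [Nonempty V] : (0 : ℝ) < Fintype.card V := by
  exact_mod_cast Fintype.card_pos

/-- Passing from nonzero directions to all directions. -/
lemma count_pairs {V : Type} [AddCommGroup V] [Fintype V] (P G : V × V → Prop) {ε : ℝ}
    (h0 : ∀ a, G (a, 0)) (h1 : ∀ p, P p → G p)
    (h : (Nat.card {p : V × V // p.2 ≠ 0 ∧ P p} : ℝ) / (Nat.card {p : V × V // p.2 ≠ 0} : ℝ) = ε)
    (he : 0 < ε) :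
    ε ≤ 1 ∧ ε * (Fintype.card V : ℝ) ^ 2 ≤ cnt G := by
  rw [← cnt_eq_natCard, ← cnt_eq_natCard] at h
  set X := cnt fun p : V × V => p.2 ≠ 0 ∧ P p
  set Y := cnt fun p : V × V => p.2 ≠ 0
  set Z := cnt fun p : V × V => ¬ p.2 ≠ 0 with hZ
  have hY0 : 0 ≤ Y := cnt_nonneg _
  have hZ0 : 0 ≤ Z := cnt_nonneg _
  have hXY : X ≤ Y := cnt_mono fun p hp => hp.1
  have hYp : 0 < Y := by
    rcases hY0.lt_or_eq with h2 | h2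
    · exact h2
    · rw [← h2, div_zero] at h; linarith
  have hX : X = ε * Y := by rw [← h]; field_simp
  have hle : ε ≤ 1 := by rw [← h, div_le_one hYp]; exact hXY
  have hsum : Y + Z = (Fintype.card V : ℝ) ^ 2 := by
    rw [cnt_add_not (fun p : V × V => p.2 ≠ 0), Fintype.card_prod]; push_cast; ring
  have hG : X + Z ≤ cnt G := by
    unfold X Z cnt
    rw [← Finset.sum_add_distrib]
    refine Finset.sum_le_sum fun p _ => ?_
    by_cases hp : p.2 = 0
    · have : p = (p.1, 0) := by rw [← hp]
      have hg : G p := by rw [this]; exact h0 _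
      rw [ind_true hg, ind_false (by tauto), ind_true (by tauto)]; norm_num
    · rw [ind_false (P := ¬ p.2 ≠ 0) (by tauto), add_zero]
      exact ind_mono fun h => h1 _ h.2
  refine ⟨hle, ?_⟩
  rw [← hsum]
  nlinarith

lemma main_case (ι : F →+* K) (d : ℕ) (f : (Fin 3 → F) → K) {ε : ℝ} (h0 : 0 < ε) (h1 : ε ≤ 1)
    (hG : ε * (Fintype.card (Fin 3 → F) : ℝ) ^ 2 ≤
      cnt (fun p : (Fin 3 → F) × (Fin 3 → F) => Good ι d f p.1 p.2))
    (hd : (d : ℝ) + 1 ≤ 1 / 100 / 8 ^ 3 * ε ^ 3 * Fintype.card F) :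
    ∃ Q, IsDegLE ι 3 d Q ∧ ε / 2 ≤ agr Q f := by
  obtain ⟨R, hR, hc⟩ := PV_fin ι d 3 le_rfl f ε h0 h1 hG hd
  have hN : (0 : ℝ) < Fintype.card (Fin 3 → F) := card_pos'
  have hq : (0 : ℝ) < Fintype.card F := card_pos'
  set N : ℝ := (Fintype.card (Fin 3 → F) : ℝ) with hNdef
  set q : ℝ := (Fintype.card F : ℝ) with hqdef
  have he2 : ε ^ 3 ≤ ε := by
    calc ε ^ 3 = ε * ε ^ 2 := by ring
      _ ≤ ε * 1 := by gcongr; exact pow_le_one₀ h0.le h1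
      _ = ε := by ring
  have hd2 : (d : ℝ) + 1 ≤ 1 / 51200 * ε * q := by
    refine hd.trans ?_
    norm_num
    gcongr
  have h9 : (9 * d : ℝ) < ε / 2 * q := by nlinarith [mul_pos h0 hq]
  have h9' : (9 * d : ℝ) < q := by nlinarith
  have h9n : 9 * d < Fintype.card F := by
    have : ((9 * d : ℕ) : ℝ) < (Fintype.card F : ℝ) := by push_cast; exact h9'
    exact_mod_cast this
  obtain ⟨P, hPd, hPe⟩ := toMv ι (D := 3 * d) (by omega) 3 R hR
  have hPd' : P.totalDegree ≤ 9 * d := by omega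
  -- points
  have hpt : cnt (fun p : (Fin 3 → F) × (Fin 3 → F) => Good ι d f p.1 p.2 ∧
        ∀ t : F, f (p.1 + t • p.2) = R (p.1 + t • p.2)) ≤ cnt (fun x => R x = f x) * N := by
    rw [cnt_prod]
    have : ∀ a, cnt (fun b => Good ι d f (a, b).1 (a, b).2 ∧
        ∀ t : F, f ((a, b).1 + t • (a, b).2) = R ((a, b).1 + t • (a, b).2)) ≤
        ind (R a = f a) * N := by
      intro a
      by_cases h : R a = f a
      · rw [ind_true h, one_mul]; exact cnt_le_card _
      · rw [ind_false h, zero_mul]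
        unfold cnt
        refine le_of_eq (Finset.sum_eq_zero fun b _ => ind_false ?_)
        rintro ⟨_, h2⟩
        have := h2 0
        simp only [zero_smul, add_zero] at this
        exact h this.symm
    refine (Finset.sum_le_sum fun a _ => this a).trans (le_of_eq ?_)
    rw [← Finset.sum_mul]; rfl
  have hdir : cnt (fun p : (Fin 3 → F) × (Fin 3 → F) => Good ι d f p.1 p.2 ∧
        ∀ t : F, f (p.1 + t • p.2) = R (p.1 + t • p.2)) ≤
        cnt (fun b : Fin 3 → F => ∃ a : Fin 3 → F, Good ι d (fun x : Fin 3 → F => MvPolynomial.eval (fun i => ι (x i)) P) a b) * N := by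
    rw [cnt_prod']
    have : ∀ b, cnt (fun a => Good ι d f (a, b).1 (a, b).2 ∧
        ∀ t : F, f ((a, b).1 + t • (a, b).2) = R ((a, b).1 + t • (a, b).2)) ≤
        ind (∃ a, Good ι d (fun x : Fin 3 → F => MvPolynomial.eval (fun i => ι (x i)) P) a b) * N := by
      intro b
      by_cases h : ∃ a, Good ι d (fun x : Fin 3 → F => MvPolynomial.eval (fun i => ι (x i)) P) a b
      · rw [ind_true h, one_mul]; exact cnt_le_card _
      · rw [ind_false h, zero_mul]
        unfold cnt
        refine le_of_eq (Finset.sum_eq_zero fun a _ => ind_false ?_)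
        rintro ⟨⟨p, hp, hpe⟩, h2⟩
        refine h ⟨a, p, hp, fun t => ?_⟩
        exact (hPe _).symm.trans ((h2 t).symm.trans (hpe t))
    refine (Finset.sum_le_sum fun a _ => this a).trans (le_of_eq ?_)
    rw [← Finset.sum_mul]; rfl
  have key : ∀ c : ℝ, cnt (fun p : (Fin 3 → F) × (Fin 3 → F) => Good ι d f p.1 p.2 ∧
        ∀ t : F, f (p.1 + t • p.2) = R (p.1 + t • p.2)) ≤ c * N → ε / 2 * N ≤ c := by
    intro c h
    have := hc.trans h
    rw [pow_two, ← mul_assoc] at this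
    exact le_of_mul_le_mul_right this hN
  refine ⟨R, ⟨P, ?_, hPe⟩, ?_⟩
  · refine deg_reduce ι P (by omega) ?_
    have h3 := key _ hdir
    have h4 : (P.totalDegree : ℝ) ≤ 9 * d := by exact_mod_cast hPd'
    calc (P.totalDegree : ℝ) * N ≤ 9 * d * N := by gcongr
      _ < ε / 2 * q * N := by gcongr
      _ = ε / 2 * N * q := by ring
      _ ≤ _ := by gcongr
  · have h3 := key _ hpt
    unfold agr
    rw [← cnt_eq_natCard, le_div_iff₀ hN]
    exact h3

lemma zero_case (ι : F →+* K) (f : (Fin 3 → F) → K) {ε : ℝ}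
    (hG : ε * (Fintype.card (Fin 3 → F) : ℝ) ^ 2 ≤
      cnt (fun p : (Fin 3 → F) × (Fin 3 → F) => Good ι 0 f p.1 p.2)) :
    ∃ Q, IsDegLE ι 3 0 Q ∧ ε ≤ agr Q f := by
  have hN : (0 : ℝ) < Fintype.card (Fin 3 → F) := card_pos'
  rw [cnt_prod] at hG
  obtain ⟨a, ha⟩ := exists_ge_of_sum (c := ε * Fintype.card (Fin 3 → F))
    (le_trans (le_of_eq (by ring)) hG)
  refine ⟨fun _ => f a, ⟨MvPolynomial.C (f a), by simp, by simp⟩, ?_⟩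
  unfold agr
  rw [← cnt_eq_natCard, le_div_iff₀ hN]
  refine ha.trans ?_
  rw [← cnt_equiv (Equiv.addLeft a) (fun x => f a = f x)]
  refine cnt_mono fun b hb => ?_
  obtain ⟨p, hp, hpe⟩ := hb
  have hp' := Polynomial.eq_C_of_natDegree_le_zero hp
  have e0 := hpe 0
  have e1 := hpe 1
  rw [hp', Polynomial.eval_C] at e0 e1
  simp only [zero_smul, add_zero, one_smul] at e0 e1
  simp only [Equiv.coe_addLeft]
  rw [e0, e1]

end fin3

/-- Line versus point test with a (deterministic) degree-`d` lines table, `m = 3`.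
A lines table is encoded per parametrization `(a, b) ↦ (t ↦ T a b t)` with `b ≠ 0`;
it must be a degree-`≤ d` function on each line and must depend only on the line as a
function on points (the consistency hypothesis). Since every affine line corresponds to
the same number of parametrizations, uniform probability over pairs `(a,b)` with `b ≠ 0`
equals uniform probability over affine lines. -/
theorem line_vs_point_table_three :
    ∃ τ : ℝ, 0 < τ ∧ τ < 1 / 20 ∧
      ∀ (Fq Fq' : Type) [Field Fq] [Fintype Fq] [Field Fq'] [Fintype Fq']
        (ι : Fq →+* Fq') (d : ℕ), d < Fintype.card Fq →
        ∀ (f : (Fin 3 → Fq) → Fq') (T : (Fin 3 → Fq) → (Fin 3 → Fq) → Fq → Fq'),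
          (∀ a b : Fin 3 → Fq, b ≠ 0 →
            ∃ p : Polynomial Fq', p.natDegree ≤ d ∧ ∀ t, T a b t = Polynomial.eval (ι t) p) →
          (∀ (a b a' b' : Fin 3 → Fq) (t t' : Fq), b ≠ 0 → b' ≠ 0 →
            Set.range (fun s : Fq => a + s • b) = Set.range (fun s : Fq => a' + s • b') →
            a + t • b = a' + t' • b' → T a b t = T a' b' t') →
          ∀ ε : ℝ,
            (Nat.card {ab : (Fin 3 → Fq) × (Fin 3 → Fq) //
                ab.2 ≠ 0 ∧ ∀ t, f (ab.1 + t • ab.2) = T ab.1 ab.2 t} : ℝ) /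
              (Nat.card {ab : (Fin 3 → Fq) × (Fin 3 → Fq) // ab.2 ≠ 0} : ℝ) = ε →
            Real.sqrt ((d : ℝ) / Fintype.card Fq) ≤ ε ^ 6 →
            ∃ Q : (Fin 3 → Fq) → Fq', IsDegLE ι 3 d Q ∧
              0.49 * ε - 1.01 * ((d : ℝ) / Fintype.card Fq) ^ τ ≤ agr Q f := by
  refine ⟨1 / 30, by norm_num, by norm_num, ?_⟩
  intro F K _ _ _ _ ι d hdq f T hT _ ε hε _
  have hq : (0 : ℝ) < Fintype.card F := card_pos'
  have hagr : ∀ Q : (Fin 3 → F) → K, 0 ≤ agr Q f := fun Q => by unfold agr; positivity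
  have hδ : (0 : ℝ) ≤ (d : ℝ) / Fintype.card F := by positivity
  have hδ' := Real.rpow_nonneg hδ (1 / 30)
  by_cases htriv : 0.49 * ε ≤ 1.01 * ((d : ℝ) / Fintype.card F) ^ (1 / 30 : ℝ)
  · exact ⟨fun _ => 0, ⟨0, by simp, by simp⟩, (sub_nonpos.2 htriv).trans (hagr _)⟩
  push Not at htriv
  have he : 0 < ε := by nlinarith
  have hε' : (Nat.card {p : (Fin 3 → F) × (Fin 3 → F) // p.2 ≠ 0 ∧
      (p.2 ≠ 0 ∧ ∀ t, f (p.1 + t • p.2) = T p.1 p.2 t)} : ℝ) /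
      (Nat.card {p : (Fin 3 → F) × (Fin 3 → F) // p.2 ≠ 0} : ℝ) = ε := by
    rw [← hε]
    simp only [← cnt_eq_natCard]
    congr 1
    exact cnt_congr fun p => by tauto
  obtain ⟨h1, hG⟩ := count_pairs
    (fun p : (Fin 3 → F) × (Fin 3 → F) => p.2 ≠ 0 ∧ ∀ t, f (p.1 + t • p.2) = T p.1 p.2 t)
    (fun p => Good ι d f p.1 p.2) (fun a => good_zero a)
    (fun p hp => by
      obtain ⟨r, hr, hre⟩ := hT p.1 p.2 hp.1
      exact ⟨r, hr, fun t => (hp.2 t).trans (hre t)⟩) hε' he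
  rcases Nat.eq_zero_or_pos d with rfl | hd
  · obtain ⟨Q, hQ, hQa⟩ := zero_case ι f hG
    refine ⟨Q, hQ, ?_⟩
    nlinarith
  · have hlt : ((d : ℝ) / Fintype.card F) ^ (1 / 30 : ℝ) ≤ ε / 2 := by linarith
    have h30 : (d : ℝ) / Fintype.card F ≤ (ε / 2) ^ 30 := by
      have h2 := pow_le_pow_left₀ hδ' hlt 30
      rw [← Real.rpow_natCast, ← Real.rpow_mul hδ] at h2
      norm_num at h2 ⊢
      exact h2
    have h3 : (ε / 2) ^ 30 ≤ ε ^ 3 / 2 ^ 30 := by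
      rw [div_pow]
      gcongr ?_ / _
      exact pow_le_pow_of_le_one he.le h1 (by norm_num)
    have h4 : (d : ℝ) ≤ ε ^ 3 / 2 ^ 30 * Fintype.card F := by
      rw [← div_le_iff₀ hq]; exact h30.trans h3
    have hd1 : (1 : ℝ) ≤ d := by exact_mod_cast hd
    obtain ⟨Q, hQ, hQa⟩ := main_case ι d f he h1 hG (by
      have : 0 < ε ^ 3 * Fintype.card F := by positivity
      norm_num at h4 ⊢
      nlinarith)
    refine ⟨Q, hQ, ?_⟩
    nlinarith

end Paper
end

section
/- Let F_q ⊆ F_{q'} be finite fields, let m ≥ 1, d ≥ 0, D ≥ 0, and let A ∈ F_{q'}[x_1,…,x_m,z] be a polynomial whose (1,…,1,d)-weighted degree is at most D, i.e., every monomial x_1^{e_1}⋯x_m^{e_m}·z^j occurring in A satisfies e_1 + ⋯ + e_m + d·j ≤ D. Suppose there is a point b ∈ F_q^m such that: (i) the univariate polynomial A(b, z) ∈ F_{q'}[z] is nonzero and has no repeated roots (in an algebraic closure of F_{q'}); and (ii) there are α ∈ F_{q'} and a set S of affine lines through b in F_q^m whose fraction among all affine lines through b is strictly greater than D/q, such that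 for every L ∈ S, fixing a parametrization L(t) = b + t·u_L with u_L ≠ 0, there is a polynomial T_L ∈ F_{q'}[t] of degree at most d with T_L(0) = α and A(L(t), T_L(t)) = 0 as a polynomial identity in t. Then there exists a polynomial P ∈ F_{q'}[x_1,…,x_m] of total degree at most d such that A(x, P(x)) = 0 identically, and moreover P(b + t·u_L) = T_L(t) as polynomials in t for every L ∈ S. -/
namespace NewtonAux
open MvPolynomial

/-- `A(b + x, z)` as a polynomial in `z` over `K[x]`. -/
noncomputable def shiftPoly {K : Type*} [Field K] {m : ℕ} (b : Fin m → K)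
    (A : MvPolynomial (Fin (m + 1)) K) : Polynomial (MvPolynomial (Fin m) K) :=
  aeval (Fin.cons Polynomial.X fun i => Polynomial.C (C (b i) + X i)) A

theorem eval_map_shiftPoly {K B : Type*} [Field K] [CommRing B] [Algebra K B] {m : ℕ}
    (b : Fin m → K) (A : MvPolynomial (Fin (m + 1)) K)
    (ψ : MvPolynomial (Fin m) K →ₐ[K] B) (T : B) :
    ((shiftPoly b A).map ψ.toRingHom).eval T =
      aeval (Fin.cons T fun i => algebraMap K B (b i) + ψ (X i)) A := by
  unfold shiftPoly
  induction A using MvPolynomial.induction_on with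
  | C a =>
    have h : ψ (algebraMap K _ a) = algebraMap K B a := ψ.commutes a
    simpa [Polynomial.algebraMap_apply] using h
  | add p q hp hq => rw [map_add, Polynomial.map_add, Polynomial.eval_add, hp, hq, map_add]
  | mul_X p i hp =>
    simp only [map_mul, Polynomial.map_mul, Polynomial.eval_mul, hp, aeval_X]
    congr 1
    refine Fin.cases ?_ (fun i => ?_) i
    · simp
    · have h : ψ (algebraMap K _ (b i)) = algebraMap K B (b i) := ψ.commutes (b i)
      simpa using h

theorem eval_shiftPoly {K : Type*} [Field K] {m : ℕ}
    (b : Fin m → K) (A : MvPolynomial (Fin (m + 1)) K) (T : MvPolynomial (Fin m) K) :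
    (shiftPoly b A).eval T = aeval (Fin.cons T fun i => C (b i) + X i) A := by
  have := eval_map_shiftPoly b A (AlgHom.id K _) T
  have h : (AlgHom.id K (MvPolynomial (Fin m) K)).toRingHom = RingHom.id _ := rfl
  rw [h, Polynomial.map_id] at this
  simpa using this

theorem map_constantCoeff_shiftPoly {K : Type*} [Field K] {m : ℕ}
    (b : Fin m → K) (A : MvPolynomial (Fin (m + 1)) K) :
    (shiftPoly b A).map constantCoeff =
      aeval (Fin.cons Polynomial.X fun i => Polynomial.C (b i)) A := by
  unfold shiftPoly
  induction A using MvPolynomial.induction_on with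
  | C a => simp [Polynomial.algebraMap_apply]
  | add p q hp hq => rw [map_add, Polynomial.map_add, hp, hq, map_add]
  | mul_X p i hp =>
    simp only [map_mul, Polynomial.map_mul, hp, aeval_X]
    congr 1
    refine Fin.cases ?_ (fun i => ?_) i <;> simp

theorem mem_idealOfVars {K : Type*} [Field K] {m : ℕ} (p : MvPolynomial (Fin m) K) :
    p ∈ idealOfVars (Fin m) K ↔ constantCoeff p = 0 := by
  rw [← pow_one (idealOfVars (Fin m) K), mem_pow_idealOfVars_iff']
  simp only [Nat.lt_one_iff, Finsupp.degree_eq_zero_iff, forall_eq]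
  rfl

/-- Newton iteration. -/
theorem exists_approx {K : Type*} [Field K] {m : ℕ}
    (F : Polynomial (MvPolynomial (Fin m) K)) (α : K)
    (h0 : (F.map constantCoeff).eval α = 0)
    (h1 : (F.map constantCoeff).derivative.eval α ≠ 0) (n : ℕ) :
    ∃ P : MvPolynomial (Fin m) K, constantCoeff P = α ∧
      F.eval P ∈ idealOfVars (Fin m) K ^ (n + 1) := by
  induction n with
  | zero =>
    refine ⟨C α, by simp, ?_⟩
    rw [zero_add, pow_one, mem_idealOfVars, ← Polynomial.eval_map_apply]
    simpa using h0
  | succ n ih =>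
    obtain ⟨P, hP, hF⟩ := ih
    set I := idealOfVars (Fin m) K
    set δ := (F.map constantCoeff).derivative.eval α with hδ
    set E := F.eval P with hE
    obtain ⟨k, hk⟩ := F.binomExpansion P (- (C δ⁻¹ * E))
    have hEI : E ∈ I := Ideal.pow_le_self (by omega) hF
    refine ⟨P + - (C δ⁻¹ * E), ?_, ?_⟩
    · rw [mem_idealOfVars] at hEI
      simp [hEI, hP]
    · rw [hk]
      have e : F.eval P + F.derivative.eval P * -(C δ⁻¹ * E) + k * (-(C δ⁻¹ * E)) ^ 2
          = E * (1 - F.derivative.eval P * C δ⁻¹ + k * C δ⁻¹ ^ 2 * E) := by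
        rw [← hE]; ring
      rw [e, pow_succ]
      refine Ideal.mul_mem_mul hF ?_
      rw [mem_idealOfVars] at hEI ⊢
      have : constantCoeff (F.derivative.eval P) = δ := by
        rw [← Polynomial.eval_map_apply, hP, hδ, Polynomial.derivative_map]
      simp [this, hEI, h1]

/-- Restriction to the line of direction `u`. -/
noncomputable def lineHom {K : Type*} [Field K] {m : ℕ} (u : Fin m → K) :
    MvPolynomial (Fin m) K →ₐ[K] Polynomial K :=
  aeval fun i => Polynomial.X * Polynomial.C (u i)

theorem lineHom_monomial {K : Type*} [Field K] {m : ℕ} (u : Fin m → K) (s : Fin m →₀ ℕ) (a : K) :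
    lineHom u (monomial s a) = Polynomial.monomial s.degree (eval u (monomial s a)) := by
  simp only [lineHom, aeval_monomial, eval_monomial, mul_pow, Finsupp.prod]
  rw [Finset.prod_mul_distrib, Finset.prod_pow_eq_pow_sum, ← Polynomial.C_mul_X_pow_eq_monomial]
  rw [Finsupp.degree_apply]
  simp
  ring

theorem coeff_lineHom {K : Type*} [Field K] {m : ℕ} (u : Fin m → K)
    (p : MvPolynomial (Fin m) K) (j : ℕ) :
    (lineHom u p).coeff j = eval u (homogeneousComponent j p) := by
  induction p using MvPolynomial.induction_on' with
  | monomial s a =>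
    rw [lineHom_monomial, Polynomial.coeff_monomial]
    rw [homogeneousComponent_of_mem (n := s.degree)]
    · by_cases h : s.degree = j
      · simp [h]
      · have : ¬ (j = s.degree) := fun h' => h h'.symm
        simp [h, this]
    · exact isHomogeneous_monomial a rfl
  | add p q hp hq => simp [hp, hq]

theorem homogeneousComponent_eq_zero_of_mem {K : Type*} [Field K] {m : ℕ}
    (p : MvPolynomial (Fin m) K) (n j : ℕ) (hj : j < n)
    (h : p ∈ idealOfVars (Fin m) K ^ n) : homogeneousComponent j p = 0 := by
  rw [mem_pow_idealOfVars_iff'] at h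
  ext s
  rw [coeff_homogeneousComponent]
  split_ifs with hs
  · rw [h s (by omega)]; simp
  · simp

theorem mem_of_homogeneousComponent {K : Type*} [Field K] {m : ℕ}
    (p : MvPolynomial (Fin m) K) (n : ℕ) 
    (h : ∀ j < n, homogeneousComponent j p = 0) : p ∈ idealOfVars (Fin m) K ^ n := by
  rw [mem_pow_idealOfVars_iff']
  intro s hs
  have := congrArg (coeff s) (h _ hs)
  simpa [coeff_homogeneousComponent] using this

theorem dvd_lineHom {K : Type*} [Field K] {m : ℕ} (u : Fin m → K)
    (p : MvPolynomial (Fin m) K) (n : ℕ) (h : p ∈ idealOfVars (Fin m) K ^ n) :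
    Polynomial.X ^ n ∣ lineHom u p := by
  rw [Polynomial.X_pow_dvd_iff]
  intro j hj
  rw [coeff_lineHom, homogeneousComponent_eq_zero_of_mem p n j hj h]
  simp

theorem eval_zero_lineHom {K : Type*} [Field K] {m : ℕ} (u : Fin m → K) :
    (Polynomial.evalRingHom 0).comp (lineHom u).toRingHom = constantCoeff := by
  ext i
  · simp [lineHom]
  · simp [lineHom]

/-- Uniqueness on lines. -/
theorem line_unique {K : Type*} [Field K] (f : Polynomial (Polynomial K))
    (P T : Polynomial K) (n : ℕ) (hPT : P.eval 0 = T.eval 0) (hT : f.eval T = 0)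
    (hP : Polynomial.X ^ n ∣ f.eval P) (hd : (f.derivative.eval P).eval 0 ≠ 0) :
    Polynomial.X ^ n ∣ T - P := by
  obtain ⟨k, hk⟩ := f.binomExpansion P (T - P)
  rw [add_sub_cancel, hT] at hk
  set w := f.derivative.eval P + k * (T - P) with hw
  have hw0 : w.eval 0 ≠ 0 := by simpa [hw, hPT] using hd
  have h1 : Polynomial.X ^ n ∣ w * (T - P) := by
    have : w * (T - P) = - f.eval P := by rw [hw]; linear_combination - hk
    rw [this]; exact hP.neg_right
  have hc : IsCoprime (Polynomial.X ^ n) w := by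
    apply IsCoprime.pow_left
    rw [Polynomial.irreducible_X.coprime_iff_not_dvd, Polynomial.X_dvd_iff,
      Polynomial.coeff_zero_eq_eval_zero]
    exact hw0
  exact hc.dvd_of_dvd_mul_left h1

theorem totalDegree_aeval_le' {K σ τ : Type*} [Field K] (p : MvPolynomial σ K)
    (g : σ → MvPolynomial τ K) (N : ℕ)
    (h : ∀ s ∈ p.support, ∑ i ∈ s.support, s i * (g i).totalDegree ≤ N) :
    (aeval g p).totalDegree ≤ N := by
  rw [aeval_def, eval₂_eq]
  apply totalDegree_finsetSum_le
  intro s hs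
  refine le_trans (totalDegree_mul _ _) ?_
  rw [algebraMap_eq, totalDegree_C, zero_add]
  refine le_trans (totalDegree_finsetProd _ _) (le_trans ?_ (h s hs))
  exact Finset.sum_le_sum fun i _ => totalDegree_pow _ _

/-- Schwartz–Zippel for homogeneous polynomials. -/
theorem sz {k K : Type*} [Field k] [Fintype k] [Field K] (ι : k →+* K) (m D e : ℕ) (hm : 1 ≤ m)
    (S : Finset (Fin m → k)) (hS0 : (0 : Fin m → k) ∉ S)
    (hSfrac : (D : ℝ) / Fintype.card k < (S.card : ℝ) / ((Fintype.card k : ℝ) ^ m - 1))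
    (he : e ≤ D) (p : MvPolynomial (Fin m) K) (hp : p.IsHomogeneous e) (he0 : 0 < e)
    (hv : ∀ u ∈ S, eval (fun i => ι (u i)) p = 0) : p = 0 := by
  classical
  by_contra hne
  have hq : 2 ≤ Fintype.card k := Fintype.one_lt_card
  set q := Fintype.card k with hqd
  let U : Finset K := Finset.univ.image ι
  have hU : U.card = q := Finset.card_image_of_injective _ ι.injective
  have key := schwartz_zippel_totalDegree hne U
  rw [hp.totalDegree hne, hU] at key
  set Z := {f ∈ Fintype.piFinset fun _ : Fin m ↦ U | eval f p = 0} with hZ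
  have hsub : (insert 0 S).card ≤ Z.card := by
    apply Finset.card_le_card_of_injOn (fun u i => ι (u i))
    · intro u hu
      have hu : u ∈ insert 0 S := hu
      show _ ∈ Z
      rw [hZ, Finset.mem_filter]
      refine ⟨by simp [U], ?_⟩
      rcases Finset.mem_insert.1 hu with rfl | hu
      · have : (fun i => ι ((0 : Fin m → k) i)) = (0 : Fin m → K) := by ext; simp
        show eval (fun i => ι ((0 : Fin m → k) i)) p = 0
        rw [this]
        have h2 : eval (0 : Fin m → K) p = constantCoeff p := by
          simp [constantCoeff_eq, eval_zero]
        rw [h2, constantCoeff_eq]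
        exact hp.coeff_eq_zero (by simpa using he0.ne)
      · exact hv u hu
    · intro u _ v _ h
      funext i
      exact ι.injective (congrFun h i)
  rw [Finset.card_insert_of_notMem hS0] at hsub
  have hcard : S.card + 1 ≤ q ^ m := by
    rw [← Finset.card_insert_of_notMem hS0]
    refine (Finset.card_le_univ _).trans ?_
    simp [hqd]
  have hq0 : (0 : ℝ) < q := by exact_mod_cast (by omega : 0 < q)
  have hqm : (1 : ℝ) < (q : ℝ) ^ m := one_lt_pow₀ (by exact_mod_cast hq) (by omega)
  have hq0' : (0 : ℚ≥0) < q := by exact_mod_cast (by omega : 0 < q)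
  rw [div_le_div_iff₀ (pow_pos hq0' m) hq0'] at key
  have key1 : Z.card * q ≤ e * q ^ m := by exact_mod_cast key
  have key2 : (Z.card : ℝ) * q ≤ e * (q : ℝ) ^ m := by exact_mod_cast key1
  have hsub' : (S.card : ℝ) + 1 ≤ Z.card := by exact_mod_cast hsub
  have hcard' : (S.card : ℝ) + 1 ≤ (q : ℝ) ^ m := by exact_mod_cast hcard
  have he' : (e : ℝ) ≤ D := by exact_mod_cast he
  rw [div_lt_div_iff₀ hq0 (by linarith)] at hSfrac
  have hDq : (D : ℝ) < q := by
    by_contra hcon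
    push Not at hcon
    nlinarith
  nlinarith

end NewtonAux

namespace NewtonAux
open MvPolynomial

theorem main_aux {Fq K : Type*} [Field Fq] [Fintype Fq] [Field K]
    (ι : Fq →+* K) (m d D : ℕ) (hm : 1 ≤ m)
    (A : MvPolynomial (Fin (m + 1)) K)
    (hwdeg : ∀ s ∈ A.support, (∑ i : Fin m, s i.succ) + d * s 0 ≤ D)
    (b : Fin m → Fq)
    (hAb_sep : (MvPolynomial.aeval
        (Fin.cons Polynomial.X fun i => Polynomial.C (ι (b i))) A : Polynomial K).Separable)
    (α : K) (S : Finset (Fin m → Fq)) (hS0 : (0 : Fin m → Fq) ∉ S)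
    (hSfrac : (D : ℝ) / Fintype.card Fq <
      (S.card : ℝ) / ((Fintype.card Fq : ℝ) ^ m - 1))
    (T : (Fin m → Fq) → Polynomial K)
    (hT : ∀ u ∈ S, (T u).natDegree ≤ d ∧ (T u).eval 0 = α ∧
      MvPolynomial.aeval
        (Fin.cons (T u) fun i =>
          Polynomial.C (ι (b i)) + Polynomial.X * Polynomial.C (ι (u i))) A = 0) :
    ∃ P : MvPolynomial (Fin m) K, P.totalDegree ≤ d ∧
      MvPolynomial.aeval (Fin.cons P fun i => MvPolynomial.X i) A = 0 ∧
      ∀ u ∈ S,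
        MvPolynomial.aeval
          (fun i => Polynomial.C (ι (b i)) + Polynomial.X * Polynomial.C (ι (u i))) P =
        T u := by
  classical
  set b' : Fin m → K := fun i => ι (b i) with hb'
  set F := shiftPoly b' A with hF
  let L : (Fin m → Fq) → MvPolynomial (Fin m) K →ₐ[K] Polynomial K :=
    fun u => lineHom fun i => ι (u i)
  have hFc : F.map constantCoeff =
      aeval (Fin.cons Polynomial.X fun i => Polynomial.C (ι (b i))) A :=
    map_constantCoeff_shiftPoly b' A
  have hTF : ∀ u ∈ S, (F.map (L u).toRingHom).eval (T u) = 0 := by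
    intro u hu
    rw [hF, eval_map_shiftPoly, ← (hT u hu).2.2]
    congr 2
    simp [L, lineHom, hb', Polynomial.algebraMap_apply]
  have hne : S.Nonempty := by
    rw [Finset.nonempty_iff_ne_empty]
    rintro rfl
    simp only [Finset.card_empty, Nat.cast_zero, zero_div] at hSfrac
    exact absurd hSfrac (not_lt.2 (by positivity))
  have h0 : (F.map constantCoeff).eval α = 0 := by
    obtain ⟨u, hu⟩ := hne
    have h := congrArg (Polynomial.evalRingHom 0) (hTF u hu)
    rw [← Polynomial.eval_map_apply, Polynomial.map_map, eval_zero_lineHom] at h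
    simpa [(hT u hu).2.1] using h
  have h1 : (F.map constantCoeff).derivative.eval α ≠ 0 := by
    have hs : (F.map constantCoeff).Separable := by rw [hFc]; exact hAb_sep
    have := hs.eval₂_derivative_ne_zero (RingHom.id K) (x := α) (by simpa using h0)
    simpa using this
  set k := max d D with hk
  obtain ⟨Q, hQα, hQ⟩ := exists_approx F α h0 h1 k
  set I := idealOfVars (Fin m) K with hI
  -- the approximation on lines
  have hline : ∀ u ∈ S, Polynomial.X ^ (k + 1) ∣ T u - L u Q := by
    intro u hu
    have hcomp : ∀ p, (L u p).eval 0 = constantCoeff p := fun p =>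
      RingHom.congr_fun (eval_zero_lineHom fun i => ι (u i)) p
    refine line_unique (F.map (L u).toRingHom) _ _ _ ?_ (hTF u hu) ?_ ?_
    · rw [hcomp, hQα, (hT u hu).2.1]
    · have := dvd_lineHom (fun i => ι (u i)) _ _ hQ
      rw [show (L u Q) = (L u).toRingHom Q from rfl, Polynomial.eval_map_apply]
      exact this
    · rw [show (L u Q) = (L u).toRingHom Q from rfl, Polynomial.derivative_map,
        Polynomial.eval_map_apply]
      have h2 := hcomp (F.derivative.eval Q)
      rw [← Polynomial.eval_map_apply, hQα, ← Polynomial.derivative_map] at h2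
      have h3 : ((L u).toRingHom (F.derivative.eval Q)).eval 0 = _ := h2
      rw [h3]
      exact h1
  have hcomp0 : ∀ j, d < j → j ≤ k → homogeneousComponent j Q = 0 := by
    intro j hdj hjk
    have hjD : j ≤ D := by omega
    refine sz ι m D j hm S hS0 hSfrac hjD _ (homogeneousComponent_isHomogeneous j Q)
      (by omega) ?_
    intro u hu
    rw [← coeff_lineHom]
    have h2 := (Polynomial.X_pow_dvd_iff.1 (hline u hu)) j (by omega)
    rw [Polynomial.coeff_sub, Polynomial.coeff_eq_zero_of_natDegree_lt
      (lt_of_le_of_lt (hT u hu).1 hdj), zero_sub, neg_eq_zero] at h2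
    exact h2
  set P := ∑ j ∈ Finset.range (d + 1), homogeneousComponent j Q with hP
  have hPdeg : P.totalDegree ≤ d := by
    apply totalDegree_finsetSum_le
    intro j hj
    exact (homogeneousComponent_isHomogeneous j Q).totalDegree_le.trans
      (by simpa [Nat.lt_succ_iff] using hj)
  have hPQ : P - Q ∈ I ^ (k + 1) := by
    apply mem_of_homogeneousComponent
    intro j hj
    rw [map_sub, hP, map_sum, sub_eq_zero]
    simp only [homogeneousComponent_of_mem (homogeneousComponent_mem _ Q)]
    rw [Finset.sum_ite_eq]
    split_ifs with h
    · rfl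
    · rw [hcomp0 j (by simpa using h) (by omega)]
  have hFP : F.eval P = 0 := by
    have h2 : F.eval P ∈ I ^ (k + 1) := by
      obtain ⟨z, hz⟩ := F.evalSubFactor P Q
      rw [sub_eq_iff_eq_add] at hz
      rw [hz]
      exact add_mem (Ideal.mul_mem_left _ _ hPQ) hQ
    have h3 : (F.eval P).totalDegree ≤ D := by
      rw [hF, eval_shiftPoly]
      apply totalDegree_aeval_le'
      intro s hs
      refine le_trans ?_ (hwdeg s hs)
      refine le_trans (Finset.sum_le_univ_sum_of_nonneg fun _ => Nat.zero_le _) ?_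
      rw [Fin.sum_univ_succ, add_comm]
      refine add_le_add (Finset.sum_le_sum fun i _ => ?_) ?_
      · rw [Fin.cons_succ]
        have : (C (b' i) + X i : MvPolynomial (Fin m) K).totalDegree ≤ 1 :=
          (totalDegree_add _ _).trans (by simp)
        nlinarith
      · rw [Fin.cons_zero]
        nlinarith
    rw [mem_pow_idealOfVars_iff] at h2
    by_contra hne0
    obtain ⟨s, hs⟩ := support_nonempty.2 hne0
    have h4 := h2 s hs
    have h5 := le_totalDegree hs
    rw [Finsupp.degree_apply] at h4
    have h6 : (s.sum fun _ e => e) = ∑ i ∈ s.support, s i := rfl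
    omega
  have hLP : ∀ u ∈ S, L u P = T u := by
    intro u hu
    have h2 : Polynomial.X ^ (k + 1) ∣ L u P - T u := by
      have h3 := dvd_lineHom (fun i => ι (u i)) _ _ hPQ
      have h4 : L u P - T u = lineHom (fun i => ι (u i)) (P - Q) - (T u - L u Q) := by
        rw [map_sub]; ring
      rw [h4]
      exact dvd_sub h3 (hline u hu)
    rw [Polynomial.X_pow_dvd_iff] at h2
    ext j
    by_cases hj : j < k + 1
    · have := h2 j hj
      rwa [Polynomial.coeff_sub, sub_eq_zero] at this
    · rw [Polynomial.coeff_eq_zero_of_natDegree_lt (lt_of_le_of_lt (hT u hu).1 (by omega))]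
      rw [coeff_lineHom, homogeneousComponent_eq_zero _ _ (by omega)]
      simp
  refine ⟨aeval (fun i => X i - C (b' i)) P, ?_, ?_, ?_⟩
  · apply totalDegree_aeval_le'
    intro s hs
    refine le_trans ?_ ((le_totalDegree hs).trans hPdeg)
    refine Finset.sum_le_sum fun i _ => ?_
    have : (X i - C (b' i) : MvPolynomial (Fin m) K).totalDegree ≤ 1 :=
      (totalDegree_sub _ _).trans (by simp)
    nlinarith
  · have h2 := congrArg (aeval (fun i => X i - C (b' i) : Fin m → MvPolynomial (Fin m) K)) hFP
    have h3 := eval_map_shiftPoly b' A (aeval (fun i => X i - C (b' i) :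
      Fin m → MvPolynomial (Fin m) K)) (aeval (fun i => X i - C (b' i)) P)
    rw [map_zero] at h2
    have h4 := Polynomial.eval_map_apply (f := (aeval (fun i => X i - C (b' i) :
      Fin m → MvPolynomial (Fin m) K)).toRingHom) (p := F) P
    have h5 := h4.trans h2
    have h6 := h3.symm.trans h5
    rw [← h6]
    congr 2
    funext i
    simp [algebraMap_eq]
  · intro u hu
    rw [← hLP u hu]
    simp only [L, lineHom]
    rw [← AlgHom.comp_apply]
    congr 1
    ext i
    simp [hb', Polynomial.algebraMap_apply]

end NewtonAux

/-- Newton-type lifting lemma for the line versus point test. Variables of the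
`(m+1)`-variate polynomial `A` are indexed by `Fin (m+1)`, with index `0` playing the role
of `z` and index `i.succ` the role of `x_i`; the `(1,…,1,d)`-weighted degree bound says that
every monomial `x₁^{e₁}⋯x_m^{e_m}·z^j` of `A` satisfies `e₁ + ⋯ + e_m + d·j ≤ D`.
The set `S` of affine lines through `b` is encoded by a set of nonzero direction vectors
closed under nonzero scaling, so that the fraction of lines through `b` represented by `S`
is `|S|/(q^m − 1)`. -/
theorem newton_lifting {Fq Fq' : Type*} [Field Fq] [Fintype Fq] [Field Fq'] [Fintype Fq']
    (ι : Fq →+* Fq') (m d D : ℕ) (hm : 1 ≤ m)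
    (A : MvPolynomial (Fin (m + 1)) Fq')
    (hwdeg : ∀ s ∈ A.support, (∑ i : Fin m, s i.succ) + d * s 0 ≤ D)
    (b : Fin m → Fq)
    (hAb_ne : (MvPolynomial.aeval
        (Fin.cons Polynomial.X fun i => Polynomial.C (ι (b i))) A : Polynomial Fq') ≠ 0)
    (hAb_sep : (MvPolynomial.aeval
        (Fin.cons Polynomial.X fun i => Polynomial.C (ι (b i))) A : Polynomial Fq').Separable)
    (α : Fq') (S : Finset (Fin m → Fq)) (hS0 : (0 : Fin m → Fq) ∉ S)
    (hSscale : ∀ u ∈ S, ∀ c : Fq, c ≠ 0 → c • u ∈ S)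
    (hSfrac : (D : ℝ) / Fintype.card Fq <
      (S.card : ℝ) / ((Fintype.card Fq : ℝ) ^ m - 1))
    (T : (Fin m → Fq) → Polynomial Fq')
    (hT : ∀ u ∈ S, (T u).natDegree ≤ d ∧ (T u).eval 0 = α ∧
      MvPolynomial.aeval
        (Fin.cons (T u) fun i =>
          Polynomial.C (ι (b i)) + Polynomial.X * Polynomial.C (ι (u i))) A = 0) :
    ∃ P : MvPolynomial (Fin m) Fq', P.totalDegree ≤ d ∧
      MvPolynomial.aeval (Fin.cons P fun i => MvPolynomial.X i) A = 0 ∧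
      ∀ u ∈ S,
        MvPolynomial.aeval
          (fun i => Polynomial.C (ι (b i)) + Polynomial.X * Polynomial.C (ι (u i))) P =
        T u := by

  exact NewtonAux.main_aux ι m d D hm A hwdeg b hAb_sep α S hS0 hSfrac T hT
end
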